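/- arXiv:2603.15233 — 2 statements merged into one kernel-verified Lean document; each statement's English description precedes it below -/
import Mathlib

section
/- Define f(𝒳,n) for integers 𝒳, n ≥ 1 by f(𝒳,n) = 1/π whenever 1 ≤ 𝒳 ≤ 7 or n ∈ {1,2}, and f(𝒳,n) = (2/3)·f(𝒳−1, n−1) + (1/3)·f(𝒳−1, n+1) + 4/((𝒳−1)(𝒳−2)) for n ≥ 3 and 𝒳 ≥ 8. Then there is a constant K > 0 such that for all integers 𝒳 ≥ 1 and all n with 1 ≤ n ≤ 𝒳/5, one has |f(𝒳,n) − 1/π| ≤ K/𝒳; that is, f(𝒳,n) = 1/π + O(1/𝒳) uniformly for n ≤ 𝒳/5 as 𝒳 → ∞. -/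
noncomputable section

namespace WittenAsym

/-- The comparison function `f(𝒳,n)`: `f(𝒳,n) = 1/π` for `𝒳 ≤ 7` or `n ≤ 2`, and
`f(𝒳,n) = (2/3)f(𝒳−1,n−1) + (1/3)f(𝒳−1,n+1) + 4/((𝒳−1)(𝒳−2))` for `n ≥ 3`, `𝒳 ≥ 8`. -/
noncomputable def f (X n : ℕ) : ℝ :=
  if h : X ≤ 7 ∨ n ≤ 2 then 1 / Real.pi
  else (2 / 3) * f (X - 1) (n - 1) + (1 / 3) * f (X - 1) (n + 1) +
    4 / (((X : ℝ) - 1) * ((X : ℝ) - 2))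
termination_by X
decreasing_by all_goals omega

theorem f_base (X n : ℕ) (h : X ≤ 7 ∨ n ≤ 2) : f X n = 1 / Real.pi := by
  rw [f, dif_pos h]

theorem f_step (X n : ℕ) (h : 7 ≤ X) (hn : 2 ≤ n) : f (X + 1) (n + 1) - 1 / Real.pi =
    (2 / 3) * (f X n - 1 / Real.pi) + (1 / 3) * (f X (n + 2) - 1 / Real.pi) +
    4 / ((X : ℝ) * ((X : ℝ) - 1)) := by
  rw [f, dif_neg (by omega)]
  simp only [Nat.add_sub_cancel]
  push_cast
  rw [show (X : ℝ) + 1 - 1 = X by ring, show (X : ℝ) + 1 - 2 = X - 1 by ring]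
  ring

theorem g_nonneg (X : ℕ) : ∀ n, 0 ≤ f X n - 1 / Real.pi := by
  induction X with
  | zero => intro n; rw [f_base 0 n (by omega)]; simp
  | succ X ih =>
    intro n
    by_cases h : X + 1 ≤ 7 ∨ n ≤ 2
    · rw [f_base _ n h]; simp
    · obtain ⟨m, rfl⟩ : ∃ m, n = m + 1 := ⟨n - 1, by omega⟩
      rw [f_step X m (by omega) (by omega)]
      have h1 := ih m
      have h2 := ih (m + 2)
      have hX : (7 : ℝ) ≤ X := by exact_mod_cast (by omega : 7 ≤ X)
      have h3 : 0 ≤ 4 / ((X : ℝ) * ((X : ℝ) - 1)) :=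
        div_nonneg (by norm_num) (mul_nonneg (by linarith) (by linarith))
      linarith

theorem g_le_aux (X : ℕ) (hX : 7 ≤ X) :
    ∀ n, f X n - 1 / Real.pi ≤ 1 - 4 / ((X : ℝ) - 1) := by
  induction X, hX using Nat.le_induction with
  | base => intro n; rw [f_base 7 n (by omega)]; norm_num
  | succ X hX ih =>
    intro n
    have hX' : (7 : ℝ) ≤ X := by exact_mod_cast hX
    push_cast
    rw [show (X : ℝ) + 1 - 1 = X by ring]
    by_cases h : n ≤ 2
    · rw [f_base _ n (Or.inr h), sub_self, sub_nonneg, div_le_one (by linarith)]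
      linarith
    · obtain ⟨m, rfl⟩ : ∃ m, n = m + 1 := ⟨n - 1, by omega⟩
      rw [f_step X m (by omega) (by omega)]
      have h1 := ih m
      have h2 := ih (m + 2)
      have h3 : 4 / ((X : ℝ) * ((X : ℝ) - 1)) = 4 / ((X : ℝ) - 1) - 4 / (X : ℝ) := by
        have : (X : ℝ) - 1 ≠ 0 := by linarith
        have : (X : ℝ) ≠ 0 := by linarith
        field_simp
        ring
      linarith

theorem g_le_one (X n : ℕ) : f X n - 1 / Real.pi ≤ 1 := by
  by_cases h : X ≤ 7
  · rw [f_base _ n (Or.inl h)]; simp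
  · have h1 := g_le_aux X (by omega) n
    have hX' : (7 : ℝ) ≤ X := by exact_mod_cast (by omega : 7 ≤ X)
    have : 0 ≤ 4 / ((X : ℝ) - 1) := div_nonneg (by norm_num) (by linarith)
    linarith

/-- The growth rate of the exponential barrier. -/
def q : ℝ := 51 / 50

theorem q_pos : 0 < q := by unfold q; norm_num

/-- Supersolution inequality for the rational part. -/
theorem rat_step (x y : ℝ) (hx : 1999 ≤ x) (hy : x + 1 ≤ 4 * y) :
    (2 / 3) * (16 / (y + 2) - 16 / x) + (1 / 3) * (16 / (y - 4) - 16 / x)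
      + 4 / (x * (x - 1)) ≤ 16 / y - 16 / (x + 1) := by
  have hy' : 500 ≤ y := by linarith
  have e1 : (2 / 3) * (16 / (y + 2)) + (1 / 3) * (16 / (y - 4)) - 16 / y
      = 128 / (y * (y + 2) * (y - 4)) := by
    have : y ≠ 0 := by linarith
    have : y + 2 ≠ 0 := by linarith
    have : y - 4 ≠ 0 := by linarith
    field_simp
    ring
  have e2 : 16 / x - 16 / (x + 1) = 16 / (x * (x + 1)) := by
    have : x ≠ 0 := by linarith
    have : x + 1 ≠ 0 := by linarith
    field_simp
    ring
  have hxx : 0 < x * (x + 1) := mul_pos (by linarith) (by linarith)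
  have b1 : 4 / (x * (x - 1)) ≤ 8 / (x * (x + 1)) := by
    rw [div_le_div_iff₀ (mul_pos (by linarith) (by linarith)) hxx]
    nlinarith
  have b2 : 128 / (y * (y + 2) * (y - 4)) ≤ 8 / (x * (x + 1)) := by
    rw [div_le_div_iff₀
      (mul_pos (mul_pos (by linarith) (by linarith)) (by linarith)) hxx]
    have k1 : x * (x + 1) ≤ (4 * y) * (4 * y) :=
      mul_le_mul (by linarith) hy (by linarith) (by linarith)
    have k2 : 256 * y ≤ (y + 2) * (y - 4) := by nlinarith
    have k3 : y * (256 * y) ≤ y * ((y + 2) * (y - 4)) :=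
      mul_le_mul_of_nonneg_left k2 (by linarith)
    nlinarith
  have e3 : 16 / (x * (x + 1)) = 8 / (x * (x + 1)) + 8 / (x * (x + 1)) := by ring
  linarith

/-- Supersolution inequality for the exponential part. -/
theorem exp_step (k : ℤ) :
    (2 / 3) * q ^ (k - 3) + (1 / 3) * q ^ (k + 5) ≤ q ^ k := by
  rw [zpow_sub₀ q_pos.ne', zpow_add₀ q_pos.ne']
  have hk : 0 < q ^ k := zpow_pos q_pos k
  have h : (2 / 3) * (1 / q ^ (3 : ℤ)) + (1 / 3) * q ^ (5 : ℤ) ≤ 1 := by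
    unfold q; norm_num
  calc _ = q ^ k * ((2 / 3) * (1 / q ^ (3 : ℤ)) + (1 / 3) * q ^ (5 : ℤ)) := by ring
    _ ≤ q ^ k * 1 := mul_le_mul_of_nonneg_left h hk.le
    _ = _ := mul_one _

theorem barrier (X : ℕ) : ∀ n : ℕ, 3 * n < X → f X n - 1 / Real.pi ≤
    16 / ((X : ℝ) - 3 * n) - 16 / X + q ^ (2000 + 4 * (n : ℤ) - X) := by
  induction X with
  | zero => intro n hn; omega
  | succ X ih =>
    intro n hn
    have hnR : 3 * (n : ℝ) < ((X + 1 : ℕ) : ℝ) := by exact_mod_cast hn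
    have hn0 : (0 : ℝ) ≤ n := Nat.cast_nonneg n
    have hpos : 0 ≤ 16 / (((X + 1 : ℕ) : ℝ) - 3 * n) - 16 / ((X + 1 : ℕ) : ℝ) :=
      sub_nonneg.2 (div_le_div_of_nonneg_left (by norm_num) (by linarith) (by linarith))
    by_cases h : X + 1 < 2000 ∨ X + 1 ≤ 4 * n
    · have h1 := g_le_one (X + 1) n
      have h2 : 1 ≤ q ^ (2000 + 4 * (n : ℤ) - ((X + 1 : ℕ) : ℤ)) :=
        one_le_zpow₀ (by unfold q; norm_num) (by omega)
      linarith
    by_cases h2 : n ≤ 2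
    · rw [f_base _ n (Or.inr h2), sub_self]
      have := zpow_pos q_pos (2000 + 4 * (n : ℤ) - ((X + 1 : ℕ) : ℤ))
      linarith
    obtain ⟨m, rfl⟩ : ∃ m, n = m + 1 := ⟨n - 1, by omega⟩
    rw [f_step X m (by omega) (by omega)]
    have i1 := ih m (by omega)
    have i2 := ih (m + 2) (by omega)
    have hx : (1999 : ℝ) ≤ X := by exact_mod_cast (by omega : 1999 ≤ X)
    have hy : (4 : ℝ) * (m + 1) ≤ X + 1 := by
      exact_mod_cast (by omega : 4 * (m + 1) ≤ X + 1)
    have r := rat_step X ((X : ℝ) + 1 - 3 * (m + 1)) hx (by linarith)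
    have e := exp_step (2000 + 4 * ((m + 1 : ℕ) : ℤ) - ((X + 1 : ℕ) : ℤ))
    rw [show (2000 + 4 * ((m + 1 : ℕ) : ℤ) - ((X + 1 : ℕ) : ℤ)) - 3 = 2000 + 4 * (m : ℤ) - X by
        push_cast; ring,
      show (2000 + 4 * ((m + 1 : ℕ) : ℤ) - ((X + 1 : ℕ) : ℤ)) + 5
        = 2000 + 4 * ((m + 2 : ℕ) : ℤ) - X by push_cast; ring] at e
    rw [show (X : ℝ) + 1 - 3 * (m + 1) + 2 = X - 3 * m by ring,
      show (X : ℝ) + 1 - 3 * (m + 1) - 4 = X - 3 * ((m + 2 : ℕ) : ℝ) by push_cast; ring] at r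
    have c1 : (((X + 1 : ℕ) : ℝ) - 3 * ((m + 1 : ℕ) : ℝ)) = (X : ℝ) + 1 - 3 * (m + 1) := by
      push_cast; ring
    have c2 : ((X + 1 : ℕ) : ℝ) = (X : ℝ) + 1 := by push_cast; ring
    rw [c1, c2]
    linarith

/-- Uniform asymptotics of `f`: there is `K > 0` with `|f(𝒳,n) − 1/π| ≤ K/𝒳`
for all `𝒳 ≥ 1` and `1 ≤ n ≤ 𝒳/5`. -/
theorem f_asymptotics :
    ∃ K : ℝ, 0 < K ∧ ∀ X n : ℕ, 1 ≤ X → 1 ≤ n → (n : ℝ) ≤ (X : ℝ) / 5 →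
      |f X n - 1 / Real.pi| ≤ K / (X : ℝ) := by
  have hQ : 0 < q ^ (2000 : ℤ) := zpow_pos q_pos _
  refine ⟨40 + 250 * q ^ (2000 : ℤ), by linarith, ?_⟩
  intro X n hX hn h
  have hX0 : (1 : ℝ) ≤ X := by exact_mod_cast hX
  have hnX : 5 * n ≤ X := by
    have : (5 : ℝ) * n ≤ X := by linarith
    exact_mod_cast this
  rw [abs_of_nonneg (g_nonneg X n)]
  have b := barrier X n (by omega)
  have b1 : 16 / ((X : ℝ) - 3 * n) ≤ 40 / X := by
    rw [div_le_div_iff₀ (by linarith) (by linarith)]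
    linarith
  have b2 : 0 ≤ 16 / (X : ℝ) := by positivity
  obtain ⟨m, hm⟩ : ∃ m, X = 4 * n + m := ⟨X - 4 * n, by omega⟩
  have hmX : (X : ℝ) ≤ 5 * m := by exact_mod_cast (by omega : X ≤ 5 * m)
  have e : q ^ (2000 + 4 * (n : ℤ) - X) = q ^ (2000 : ℤ) / q ^ m := by
    rw [show (2000 + 4 * (n : ℤ) - X) = 2000 - (m : ℤ) by rw [hm]; push_cast; ring,
      zpow_sub₀ q_pos.ne', zpow_natCast]
  have bern : 1 + (m : ℝ) * (1 / 50) ≤ q ^ m := by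
    have := one_add_mul_le_pow (a := (1 / 50 : ℝ)) (by norm_num) m
    rwa [show (1 : ℝ) + 1 / 50 = q by unfold q; norm_num] at this
  have b3 : q ^ (2000 : ℤ) / q ^ m ≤ 250 * q ^ (2000 : ℤ) / X := by
    rw [div_le_div_iff₀ (pow_pos q_pos m) (by linarith)]
    have : (X : ℝ) ≤ 250 * q ^ m := by linarith
    calc _ ≤ q ^ (2000 : ℤ) * (250 * q ^ m) := mul_le_mul_of_nonneg_left this hQ.le
      _ = _ := by ring
  rw [add_div]
  linarith

end WittenAsym
end
end

section
/- For all integers n ≥ 1 and 𝒳 ≥ 1, one has θ_{𝒳,n} ≤ f(𝒳,n); in other words, every normalized Witten intersection number C(d) with d ∈ (Z_{≥1})^n, g(d) ∈ Z and X(d) = 𝒳 satisfies C(d) ≤ f(𝒳,n). -/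
open scoped BigOperators

noncomputable section

namespace WittenAsym

/-- `g(d)` as a rational number: `g(d) = 1 + (∑ⱼ dⱼ − n)/3`. -/
def gQ (l : List ℕ) : ℚ := 1 + ((l.sum : ℚ) - (l.length : ℚ)) / 3

/-- `X(d)` as a rational number: `X(d) = (∑ⱼ (2dⱼ+1))/3 = 2g(d) − 2 + n`. -/
def XQ (l : List ℕ) : ℚ := (2 * (l.sum : ℚ) + (l.length : ℚ)) / 3

/-- `X(d)` as a natural number (the correct value whenever `X(d)` is an integer). -/
def XN (l : List ℕ) : ℕ := (2 * l.sum + l.length) / 3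

/-- `g(d)` is a nonnegative integer. -/
def IntegralG (l : List ℕ) : Prop := ∃ g : ℕ, (g : ℚ) = gQ l

/-- The subtuple of `r` indexed by the finite index set `I`. -/
def select (r : List ℕ) (I : Finset (Fin r.length)) : List ℕ :=
  ((List.finRange r.length).filter (fun i => i ∈ I)).map r.get

/-- The characterization of the normalized Witten intersection numbers
`C(d) = 2^{2g(d)} ∏ⱼ (2dⱼ+1)!! / (3^{2g(d)-2+n} (2g(d)-3+n)!) ∫ ψ₁^{d₁}⋯ψₙ^{dₙ}`:
they form the unique family of rationals, symmetric in the entries of `d`, vanishing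
when `g(d)` is not a nonnegative integer, with `C(0,0,0) = 1/3`, `C(1) = 1/6`,
and satisfying the DVV recursion whenever `X(d) = 2g(d) - 2 + n ≥ 2`. -/
structure IsNormalizedWitten (C : List ℕ → ℚ) : Prop where
  symm : ∀ {l l' : List ℕ}, l.Perm l' → C l = C l'
  init3 : C [0, 0, 0] = 1/3
  init1 : C [1] = 1/6
  vanish : ∀ l : List ℕ, ¬ IntegralG l → C l = 0
  dvv : ∀ (d₁ : ℕ) (r : List ℕ), IntegralG (d₁ :: r) → 2 ≤ XQ (d₁ :: r) →
    C (d₁ :: r) =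
      (∑ j : Fin r.length,
        if 1 ≤ d₁ + r.get j then
          (2 * (r.get j : ℚ) + 1) / (3 * (XQ (d₁ :: r) - 1)) *
            C (r.set j.val (d₁ + r.get j - 1))
        else 0)
      + ∑ a ∈ Finset.range (d₁ - 1),
          (2 / (3 * (XQ (d₁ :: r) - 1)) * C (a :: (d₁ - 2 - a) :: r)
          + ∑ I : Finset (Fin r.length),
              if 3 ∣ (2 * (a + (select r I).sum) + (1 + (select r I).length)) then
                ((XN (a :: select r I) - 1).factorial : ℚ) *
                  ((XN ((d₁ - 2 - a) :: select r Iᶜ) - 1).factorial : ℚ) /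
                  (6 * ((XN (d₁ :: r) - 1).factorial : ℚ)) *
                  C (a :: select r I) * C ((d₁ - 2 - a) :: select r Iᶜ)
              else 0)

/-- `θ_{𝒳,m}`: the maximum of `C(e)` over tuples `e ∈ (ℤ_{≥1})^m` with `g(e) ∈ ℤ`
and `X(e) = 𝒳` (a maximum over a finite set, equal to `0` if the set is empty,
by the convention `sSup ∅ = 0` in `ℝ`). -/
noncomputable def theta (C : List ℕ → ℚ) (X m : ℕ) : ℝ :=
  sSup {x : ℝ | ∃ e : List ℕ, e.length = m ∧ (∀ i ∈ e, 1 ≤ i) ∧ IntegralG e ∧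
    XQ e = (X : ℚ) ∧ (C e : ℝ) = x}

section

/-- three times `X`. -/
def T3 (l : List ℕ) : ℕ := 2 * l.sum + l.length

/-- natural number version of `IntegralG`. -/
def IG (l : List ℕ) : Prop := ∃ g : ℕ, l.sum + 3 = 3 * g + l.length

theorem integralG_iff (l : List ℕ) : IntegralG l ↔ IG l := by
  unfold IntegralG IG gQ
  constructor
  · rintro ⟨g, hg⟩
    refine ⟨g, ?_⟩
    have : (l.sum : ℚ) + 3 = 3 * g + l.length := by rw [hg]; ring
    exact_mod_cast this
  · rintro ⟨g, hg⟩
    refine ⟨g, ?_⟩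
    have : (l.sum : ℚ) + 3 = 3 * g + l.length := by exact_mod_cast hg
    linarith

theorem XQ_eq (l : List ℕ) : XQ l = (T3 l : ℚ) / 3 := by
  unfold XQ T3; push_cast; ring

theorem sum_set_add (r : List ℕ) (j : ℕ) (hj : j < r.length) (v : ℕ) :
    (r.set j v).sum + r[j] = r.sum + v := by
  induction r generalizing j with
  | nil => simp at hj
  | cons a r ih =>
    cases j with
    | zero => simp; omega
    | succ j =>
      simp only [List.set_cons_succ, List.sum_cons, List.getElem_cons_succ]
      have := ih j (by simpa using hj)
      omega

theorem T3_set (r : List ℕ) (j : Fin r.length) (v : ℕ) :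
    T3 (r.set j v) + 2 * r.get j = T3 r + 2 * v := by
  have := sum_set_add r j j.2 v
  simp only [T3, List.length_set, List.get_eq_getElem] at *
  omega

theorem T3_cons (a : ℕ) (r : List ℕ) : T3 (a :: r) = 2 * a + 1 + T3 r := by
  simp [T3]; ring

theorem select_aux (r : List ℕ) (I : Finset (Fin r.length)) :
    ((select r I : List ℕ) : Multiset ℕ) = I.val.map r.get := by
  unfold select
  rw [← Multiset.map_coe, ← Multiset.filter_coe]
  congr 1
  have h : I = Finset.univ.filter (fun i => i ∈ I) := by ext; simp
  conv_rhs => rw [h]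
  rw [Finset.filter_val]
  simp [Finset.univ, Fintype.elems]

theorem select_length (r : List ℕ) (I : Finset (Fin r.length)) :
    (select r I).length = I.card := by
  have := congrArg Multiset.card (select_aux r I)
  rwa [Multiset.coe_card, Multiset.card_map] at this

theorem select_sum (r : List ℕ) (I : Finset (Fin r.length)) :
    (select r I).sum = ∑ i ∈ I, r.get i := by
  have := congrArg Multiset.sum (select_aux r I)
  rwa [Multiset.sum_coe] at this

theorem select_mem {r : List ℕ} {I : Finset (Fin r.length)} {x : ℕ} (h : x ∈ select r I) :
    x ∈ r := by
  have : x ∈ ((select r I : List ℕ) : Multiset ℕ) := by simpa using h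
  rw [select_aux] at this
  simp only [Multiset.mem_map] at this
  obtain ⟨i, _, hi⟩ := this
  rw [← hi]; exact List.get_mem _ _

theorem get_sum (r : List ℕ) : ∑ i : Fin r.length, r.get i = r.sum := by
  simp [Fin.sum_univ_getElem]

theorem select_sum_compl (r : List ℕ) (I : Finset (Fin r.length)) :
    (select r I).sum + (select r Iᶜ).sum = r.sum := by
  rw [select_sum, select_sum, Finset.sum_add_sum_compl, get_sum]

theorem select_length_compl (r : List ℕ) (I : Finset (Fin r.length)) :
    (select r I).length + (select r Iᶜ).length = r.length := by
  rw [select_length, select_length, Finset.card_add_card_compl, Fintype.card_fin]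

theorem sum_weight (r : List ℕ) : ∑ j : Fin r.length, (2 * (r.get j : ℚ) + 1) = T3 r := by
  rw [Finset.sum_add_distrib, ← Finset.mul_sum]
  have := get_sum r
  have h2 : (∑ j : Fin r.length, (r.get j : ℚ)) = (r.sum : ℚ) := by exact_mod_cast this
  rw [h2]; simp [T3]

section
variable {C : List ℕ → ℚ}

theorem IsNormalizedWitten.zero (hC : IsNormalizedWitten C) {l : List ℕ} (h : ¬ IG l) : C l = 0 :=
  hC.vanish l (by rwa [integralG_iff])

/-- the DVV split sum for given `a`, `b`. -/
def splitSum (C : List ℕ → ℚ) (d₁ a b : ℕ) (r : List ℕ) : ℚ :=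
  ∑ I : Finset (Fin r.length),
    if 3 ∣ (2 * (a + (select r I).sum) + (1 + (select r I).length)) then
      ((XN (a :: select r I) - 1).factorial : ℚ) *
        ((XN (b :: select r Iᶜ) - 1).factorial : ℚ) /
        (6 * ((XN (d₁ :: r) - 1).factorial : ℚ)) *
        C (a :: select r I) * C (b :: select r Iᶜ)
    else 0

theorem IsNormalizedWitten.dvv' (hC : IsNormalizedWitten C) (d : ℕ) (r : List ℕ)
    (h : IG (d :: r)) (hX : 6 ≤ T3 (d :: r)) :
    C (d :: r) = (∑ j : Fin r.length,
        if 1 ≤ d + r.get j then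
          (2 * (r.get j : ℚ) + 1) / ((T3 (d :: r) : ℚ) - 3) *
            C (r.set j.val (d + r.get j - 1))
        else 0)
      + ∑ a ∈ Finset.range (d - 1),
          (2 / ((T3 (d :: r) : ℚ) - 3) * C (a :: (d - 2 - a) :: r)
          + splitSum C d a (d - 2 - a) r) := by
  have h6 : (6:ℚ) ≤ T3 (d :: r) := by exact_mod_cast hX
  have := hC.dvv d r (by rwa [integralG_iff]) (by rw [XQ_eq]; linarith)
  have e : 3 * (XQ (d :: r) - 1) = (T3 (d :: r) : ℚ) - 3 := by rw [XQ_eq]; ring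
  rw [e] at this
  exact this

theorem IG_T3 {l : List ℕ} (h : IG l) : 3 ∣ T3 l := by
  obtain ⟨g, hg⟩ := h; unfold T3; omega

theorem T3_small {l : List ℕ} (h : IG l) (hne : l ≠ []) (h6 : T3 l < 6) :
    l = [1] ∨ l = [0,0,0] := by
  have h3 := IG_T3 h
  have hl : 0 < l.length := List.length_pos_iff.2 hne
  have hT : T3 l = 3 := by
    have : 0 < T3 l := by unfold T3; omega
    omega
  unfold T3 at hT
  match l, hT with
  | [a], hT => left; simp at hT; simp only [List.cons.injEq, and_true]; omega
  | [a, b], hT => exfalso; simp at hT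
  | [a, b, c], hT => right; simp at hT; simp; omega
  | a :: b :: c :: d :: l, hT => exfalso; simp at hT; omega

theorem IsNormalizedWitten.nonneg (hC : IsNormalizedWitten C) : ∀ (N : ℕ) (l : List ℕ),
    T3 l = N → l ≠ [] → 0 ≤ C l := by
  intro N
  induction N using Nat.strong_induction_on with
  | _ N ih =>
  intro l hN hne
  by_cases hI : IG l
  swap
  · rw [hC.zero hI]
  by_cases h6 : T3 l < 6
  · rcases T3_small hI hne h6 with h | h
    · rw [h, hC.init1]; norm_num
    · rw [h, hC.init3]; norm_num
  push Not at h6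
  obtain ⟨d, r, rfl⟩ := List.exists_cons_of_ne_nil hne
  rw [hC.dvv' d r hI h6]
  have h6' : (6:ℚ) ≤ T3 (d :: r) := by exact_mod_cast h6
  have hpos : (0:ℚ) < (T3 (d :: r) : ℚ) - 3 := by linarith
  rw [T3_cons] at hN
  refine add_nonneg (Finset.sum_nonneg ?_) (Finset.sum_nonneg ?_)
  · intro j _
    split_ifs with h1
    · refine mul_nonneg (by positivity) (ih _ ?_ _ rfl ?_)
      · have := T3_set r j (d + r.get j - 1); omega
      · intro h0
        have : (r.set j.val (d + r.get j - 1)).length = 0 := by rw [h0]; rfl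
        rw [List.length_set] at this
        have := j.2; omega
    · exact le_rfl
  · intro a ha
    rw [Finset.mem_range] at ha
    refine add_nonneg (mul_nonneg (by positivity) (ih _ ?_ _ rfl (by simp))) ?_
    · rw [T3_cons, T3_cons]; omega
    · unfold splitSum
      refine Finset.sum_nonneg ?_
      intro I _
      have h1 := select_sum_compl r I
      have h2 := select_length_compl r I
      split_ifs with h3
      · refine mul_nonneg (mul_nonneg (by positivity) (ih _ ?_ _ rfl (by simp)))
          (ih _ ?_ _ rfl (by simp))
        · rw [T3_cons]; unfold T3 at *; omega
        · rw [T3_cons]; unfold T3 at *; omega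
      · exact le_rfl

theorem IsNormalizedWitten.nn (hC : IsNormalizedWitten C) (a : ℕ) (l : List ℕ) :
    0 ≤ C (a :: l) := hC.nonneg _ _ rfl (by simp)

theorem IG_cons_one {l : List ℕ} : IG (1 :: l) ↔ IG l := by
  unfold IG; simp only [List.sum_cons, List.length_cons]
  constructor <;> rintro ⟨g, hg⟩ <;> exact ⟨g, by omega⟩

theorem IsNormalizedWitten.dilaton (hC : IsNormalizedWitten C) (l : List ℕ) (h : l ≠ []) :
    C (1 :: l) = C l := by
  by_cases hI : IG l
  swap
  · rw [hC.zero hI, hC.zero (by rwa [IG_cons_one])]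
  have hl : 0 < l.length := List.length_pos_iff.2 h
  have h3 : 3 ≤ T3 l := by
    have := IG_T3 hI
    have : 0 < T3 l := by unfold T3; omega
    omega
  have hT := T3_cons 1 l
  rw [hC.dvv' 1 l (by rwa [IG_cons_one]) (by omega), hT]
  have h3' : (3:ℚ) ≤ T3 l := by exact_mod_cast h3
  have : ∀ j : Fin l.length, (if 1 ≤ 1 + l.get j then
          (2 * (l.get j : ℚ) + 1) / (((2 * 1 + 1 + T3 l : ℕ) : ℚ) - 3) *
            C (l.set j.val (1 + l.get j - 1))
        else 0) = (2 * (l.get j : ℚ) + 1) * (C l / T3 l) := by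
    intro j
    rw [if_pos (by omega)]
    have : 1 + l.get j - 1 = l.get j := by omega
    rw [this]
    have h2 : l.set j.val (l.get j) = l := by simp
    rw [h2]
    push_cast
    have : (3 + (T3 l : ℚ) - 3) = T3 l := by ring
    norm_num; ring
  rw [Finset.sum_congr rfl (fun j _ => this j), ← Finset.sum_mul, sum_weight]
  simp
  field_simp

theorem IsNormalizedWitten.string (hC : IsNormalizedWitten C) (r : List ℕ) (h : IG (0 :: r))
    (h6 : 6 ≤ T3 (0 :: r)) :
    C (0 :: r) = ∑ j : Fin r.length,
        if 1 ≤ r.get j then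
          (2 * (r.get j : ℚ) + 1) / ((T3 r : ℚ) - 2) * C (r.set j.val (r.get j - 1))
        else 0 := by
  rw [hC.dvv' 0 r h h6]
  have hT := T3_cons 0 r
  rw [hT]
  simp only [zero_add, mul_zero, Finset.range_zero, Finset.sum_empty, add_zero, Nat.zero_sub]
  refine Finset.sum_congr rfl ?_
  intro j _
  split_ifs
  · push_cast
    have : (1 + (T3 r : ℚ) - 3) = T3 r - 2 := by ring
    rw [this]
  · rfl

end

end

section

/-- normalization factor. -/
def NF (l : List ℕ) : ℚ :=
  3 ^ (XN l) * ((XN l - 1).factorial : ℚ) / 4 ^ ((l.sum + 3 - l.length) / 3)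

theorem NF_eq {l : List ℕ} {x g : ℕ} (hx : T3 l = 3 * x) (hg : l.sum + 3 = 3 * g + l.length) :
    NF l = 3 ^ x * ((x - 1).factorial : ℚ) / 4 ^ g := by
  have h1 : XN l = x := by unfold XN; unfold T3 at hx; omega
  have h2 : (l.sum + 3 - l.length) / 3 = g := by omega
  unfold NF; rw [h1, h2]

theorem XN_eq {l : List ℕ} {x : ℕ} (hx : T3 l = 3 * x) : XN l = x := by
  unfold XN; unfold T3 at hx; omega

theorem IG_data {l : List ℕ} (h : IG l) : ∃ x g, T3 l = 3 * x ∧ l.sum + 3 = 3 * g + l.length ∧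
    x + 2 = 2 * g + l.length := by
  obtain ⟨g, hg⟩ := h
  refine ⟨2 * g + l.length - 2, g, ?_, hg, ?_⟩
  · unfold T3; omega
  · omega

theorem NF_pos (l : List ℕ) : 0 < NF l := by unfold NF; positivity

/-- Unnormalized intersection numbers. -/
def W (C : List ℕ → ℚ) (l : List ℕ) : ℚ := C l * NF l

variable {C : List ℕ → ℚ}

theorem W_zero (hC : IsNormalizedWitten C) {l : List ℕ} (h : ¬ IG l) : W C l = 0 := by
  unfold W; rw [hC.zero h, zero_mul]

theorem W_perm (hC : IsNormalizedWitten C) {l l' : List ℕ} (h : l.Perm l') : W C l = W C l' := by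
  unfold W NF XN; rw [hC.symm h, h.sum_eq, h.length_eq]

theorem fact_aux (x : ℕ) (hx : 2 ≤ x) : ((x - 1).factorial : ℚ) = ((x : ℚ) - 1) * ((x - 2).factorial : ℚ) := by
  obtain ⟨y, rfl⟩ := Nat.exists_eq_add_of_le' hx
  have : y + 2 - 1 = y + 1 := by omega
  rw [this, Nat.factorial_succ]; push_cast
  ring

theorem W_dvv (hC : IsNormalizedWitten C) (d : ℕ) (r : List ℕ)
    (h : IG (d :: r)) (hX : 6 ≤ T3 (d :: r)) :
    W C (d :: r) = (∑ j : Fin r.length,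
        if 1 ≤ d + r.get j then
          (2 * (r.get j : ℚ) + 1) * W C (r.set j.val (d + r.get j - 1))
        else 0)
      + 1 / 2 * ∑ a ∈ Finset.range (d - 1),
          (W C (a :: (d - 2 - a) :: r)
          + ∑ I : Finset (Fin r.length), W C (a :: select r I) * W C ((d - 2 - a) :: select r Iᶜ)) := by
  obtain ⟨x, g, hx, hg, hxg⟩ := IG_data h
  have hx2 : 2 ≤ x := by omega
  have hx2' : (2:ℚ) ≤ x := by exact_mod_cast hx2
  have hN := NF_eq hx hg
  rw [fact_aux x hx2] at hN
  have hden : ((T3 (d :: r) : ℚ) - 3) = 3 * ((x:ℚ) - 1) := by rw [hx]; push_cast; ring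
  have hx1 : ((x:ℚ) - 1) ≠ 0 := by
    intro h0; linarith
  have h3x : (3:ℚ) ^ x = 3 * 3 ^ (x - 1) := by
    rw [← pow_succ']; congr 1; omega
  have hTc := T3_cons d r
  have hl : (d :: r).length = r.length + 1 := rfl
  have hs : (d :: r).sum = d + r.sum := by simp
  rw [hl, hs] at hg
  unfold W
  rw [hC.dvv' d r h hX, add_mul, Finset.sum_mul, Finset.sum_mul, Finset.mul_sum, hden]
  congr 1
  · refine Finset.sum_congr rfl ?_
    intro j _
    split_ifs with h1
    · have e1 := T3_set r j (d + r.get j - 1)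
      have e2 := sum_set_add r j j.2 (d + r.get j - 1)
      have e3 : r.get j = r[j.val] := rfl
      have : NF (r.set j.val (d + r.get j - 1)) = 3 ^ (x-1) * ((x - 1 - 1).factorial : ℚ) / 4 ^ g := by
        apply NF_eq
        · omega
        · rw [List.length_set]; omega
      rw [this, hN, h3x]
      have : x - 1 - 1 = x - 2 := by omega
      rw [this]
      field_simp
    · simp
  · refine Finset.sum_congr rfl ?_
    intro a ha
    rw [Finset.mem_range] at ha
    rw [add_mul, mul_add]
    congr 1
    · by_cases hI : IG (a :: (d - 2 - a) :: r)
      swap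
      · rw [hC.zero hI]; ring
      obtain ⟨g', hg'⟩ := hI
      simp only [List.sum_cons, List.length_cons] at hg'
      have hgg : g = g' + 1 := by omega
      have : NF (a :: (d - 2 - a) :: r) = 3 ^ (x-1) * ((x - 1 - 1).factorial : ℚ) / 4 ^ g' := by
        apply NF_eq
        · rw [T3_cons, T3_cons]; omega
        · simp only [List.sum_cons, List.length_cons]; omega
      rw [this, hN, h3x, hgg, pow_succ]
      have : x - 1 - 1 = x - 2 := by omega
      rw [this]
      field_simp
      ring
    · unfold splitSum
      rw [Finset.sum_mul, Finset.mul_sum]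
      refine Finset.sum_congr rfl ?_
      intro I _
      have s1 := select_sum_compl r I
      have s2 := select_length_compl r I
      by_cases hI : IG (a :: select r I)
      swap
      · rw [hC.zero hI]; simp
      by_cases hJ : IG ((d - 2 - a) :: select r Iᶜ)
      swap
      · rw [hC.zero hJ]; simp
      obtain ⟨x1, g1, hx1', hg1, hxg1⟩ := IG_data hI
      obtain ⟨x2, g2, hx2'', hg2, hxg2⟩ := IG_data hJ
      have t1 := T3_cons a (select r I)
      have t2 := T3_cons (d-2-a) (select r Iᶜ)
      have t3 := hx1'
      have t4 := hx2''
      rw [t1] at t3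
      rw [t2] at t4
      unfold T3 at t3 t4
      rw [if_pos (by omega), NF_eq hx1' hg1, NF_eq hx2'' hg2, XN_eq hx1', XN_eq hx2'', XN_eq hx,
        hN, fact_aux x hx2]
      simp only [List.sum_cons, List.length_cons] at hg1 hg2
      have hg3 : g = g1 + g2 := by omega
      have hx3 : x = x1 + x2 + 1 := by
        unfold T3 at hTc hx; 
        simp only [List.sum_cons, List.length_cons] at hTc hx; omega
      have : (3:ℚ) ^ x = 3 * (3 ^ x1 * 3 ^ x2) := by
        rw [hx3, pow_succ, pow_add]; ring
      rw [this, hg3, pow_add]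
      have hf : ((x-2).factorial : ℚ) ≠ 0 := by positivity
      field_simp
      ring

theorem select_empty (r : List ℕ) : select r ∅ = [] := by
  unfold select; simp

theorem select_univ (r : List ℕ) : select r Finset.univ = r := by
  unfold select; simp

theorem W_one (hC : IsNormalizedWitten C) (m : ℕ) :
    W C [m+2] = 1 / 2 * ∑ a ∈ Finset.range (m+1), (W C [a, m - a] + W C [a] * W C [m-a]) := by
  by_cases h : IG [m+2]
  · have h6 : 6 ≤ T3 [m+2] := by
      obtain ⟨g, hg⟩ := h
      unfold T3; simp at hg ⊢; omega
    rw [W_dvv hC _ _ h h6]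
    simp only [List.length_nil, Finset.univ_eq_empty, Finset.sum_empty, zero_add]
    congr 1
    refine Finset.sum_congr rfl ?_
    intro a ha
    have : (Finset.univ : Finset (Finset (Fin ([] : List ℕ).length))) = {∅} := by rfl
    rw [this, Finset.sum_singleton]
    simp [select]
  · rw [W_zero hC h, Finset.sum_eq_zero]
    · simp
    intro a ha
    rw [Finset.mem_range] at ha
    have h' : ¬ ∃ g, m + 2 + 3 = 3 * g + 1 := by
      intro ⟨g, hg⟩; exact h ⟨g, by simpa using hg⟩
    rw [W_zero hC (l := [a, m-a])]
    · by_cases h1 : IG [a]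
      · rw [W_zero hC (l := [m-a])]
        · simp
        · rintro ⟨g, hg⟩
          obtain ⟨g', hg'⟩ := h1
          simp at hg hg'
          exact h' ⟨g + g', by omega⟩
      · rw [W_zero hC h1]; simp
    · rintro ⟨g, hg⟩
      simp at hg
      exact h' ⟨g+1, by omega⟩

theorem W_two (hC : IsNormalizedWitten C) (k c : ℕ) :
    W C [k+2, c] = (2 * c + 1) * W C [k+c+1] + 1 / 2 * ∑ a ∈ Finset.range (k+1),
      (W C [a, k - a, c] + (W C [a] * W C [k - a, c] + W C [a, c] * W C [k - a])) := by
  by_cases h : IG [k+2, c]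
  · have h6 : 6 ≤ T3 [k+2, c] := by
      unfold T3; simp; omega
    rw [W_dvv hC _ _ h h6]
    congr 1
    · have : (Finset.univ : Finset (Fin ([c] : List ℕ).length)) = {⟨0, by simp⟩} := by rfl
      rw [this, Finset.sum_singleton]
      simp
      rw [show k + 1 + c = k + c + 1 by omega, if_pos (by omega)]
    · congr 1
      refine Finset.sum_congr rfl ?_
      intro a ha
      have : (Finset.univ : Finset (Finset (Fin ([c] : List ℕ).length))) = {∅, Finset.univ} := by rfl
      rw [this, Finset.sum_pair (by
        intro h0
        have := congrArg Finset.card h0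
        simp at this)]
      rw [Finset.compl_empty, Finset.compl_univ, select_empty, select_univ]
      simp
  · rw [W_zero hC h, Finset.sum_eq_zero, W_zero hC (l := [k+c+1])]
    · simp
    · rintro ⟨g, hg⟩
      refine h ⟨g, ?_⟩
      simp at hg ⊢; omega
    intro a ha
    rw [Finset.mem_range] at ha
    have h' : ¬ ∃ g, k + c = 3 * g := by
      intro ⟨g, hg⟩; exact h ⟨g+1, by simp; omega⟩
    rw [W_zero hC (l := [a, k-a, c])]
    · have e1 : W C [a] * W C [k - a, c] = 0 := by
        by_cases h1 : IG [a]
        · rw [W_zero hC (l := [k-a, c])]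
          · simp
          · rintro ⟨g, hg⟩
            obtain ⟨g', hg'⟩ := h1
            simp at hg hg'
            exact h' ⟨g + g' - 1, by omega⟩
        · rw [W_zero hC h1]; simp
      have e2 : W C [a, c] * W C [k - a] = 0 := by
        by_cases h1 : IG [k - a]
        · rw [W_zero hC (l := [a, c])]
          · simp
          · rintro ⟨g, hg⟩
            obtain ⟨g', hg'⟩ := h1
            simp at hg hg'
            exact h' ⟨g + g' - 1, by omega⟩
        · rw [W_zero hC h1]; simp
      rw [e1, e2]; simp
    · rintro ⟨g, hg⟩
      simp at hg
      exact h' ⟨g, by omega⟩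

end

section

open Finset.HasAntidiagonal (antidiagonal mem_antidiagonal)

/-- sum over triples with `a+b+c=N`. -/
def Tri (N : ℕ) (φ : ℕ → ℕ → ℕ → ℚ) : ℚ :=
  ∑ p ∈ antidiagonal N, ∑ q ∈ antidiagonal p.1, φ q.1 q.2 p.2

theorem Tri_assoc (N : ℕ) (φ : ℕ → ℕ → ℕ → ℚ) :
    Tri N φ = ∑ p ∈ antidiagonal N, ∑ q ∈ antidiagonal p.2, φ p.1 q.1 q.2 := by
  unfold Tri
  rw [Finset.sum_sigma', Finset.sum_sigma']
  refine Finset.sum_nbij' (fun x => ⟨(x.2.1, x.2.2 + x.1.2), (x.2.2, x.1.2)⟩)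
    (fun x => ⟨(x.1.1 + x.2.1, x.2.2), (x.1.1, x.2.1)⟩) ?_ ?_ ?_ ?_ ?_
  · rintro ⟨⟨k, c⟩, ⟨a, b⟩⟩ h
    simp only [Finset.mem_sigma, mem_antidiagonal] at h ⊢
    refine ⟨?_, ?_⟩ <;> first | rfl | omega | trivial
  · rintro ⟨⟨k, c⟩, ⟨a, b⟩⟩ h
    simp only [Finset.mem_sigma, mem_antidiagonal] at h ⊢
    refine ⟨?_, ?_⟩ <;> first | rfl | omega | trivial
  · rintro ⟨⟨k, c⟩, ⟨a, b⟩⟩ h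
    simp only [Finset.mem_sigma, mem_antidiagonal] at h ⊢
    rw [h.2]
  · rintro ⟨⟨k, c⟩, ⟨a, b⟩⟩ h
    simp only [Finset.mem_sigma, mem_antidiagonal] at h ⊢
    rw [h.2]
  · rintro ⟨⟨k, c⟩, ⟨a, b⟩⟩ h
    rfl

theorem Tri_swap12 (N : ℕ) (φ : ℕ → ℕ → ℕ → ℚ) :
    Tri N φ = Tri N (fun a b c => φ b a c) := by
  unfold Tri
  refine Finset.sum_congr rfl ?_
  intro p _
  rw [← Finset.Nat.sum_antidiagonal_swap]
  rfl

theorem Tri_swap23 (N : ℕ) (φ : ℕ → ℕ → ℕ → ℚ) :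
    Tri N φ = Tri N (fun a b c => φ a c b) := by
  rw [Tri_assoc, Tri_assoc]
  refine Finset.sum_congr rfl ?_
  intro p _
  rw [← Finset.Nat.sum_antidiagonal_swap]
  rfl

theorem Tri_add (N : ℕ) (φ ψ : ℕ → ℕ → ℕ → ℚ) :
    Tri N (fun a b c => φ a b c + ψ a b c) = Tri N φ + Tri N ψ := by
  unfold Tri; simp only [Finset.sum_add_distrib]

theorem Tri_smul (N : ℕ) (t : ℚ) (φ : ℕ → ℕ → ℕ → ℚ) :
    Tri N (fun a b c => t * φ a b c) = t * Tri N φ := by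
  unfold Tri; simp only [Finset.mul_sum]

theorem Tri_congr (N : ℕ) {φ ψ : ℕ → ℕ → ℕ → ℚ} (h : ∀ a b c, a + b + c = N → φ a b c = ψ a b c) :
    Tri N φ = Tri N ψ := by
  unfold Tri
  refine Finset.sum_congr rfl ?_
  intro p hp
  refine Finset.sum_congr rfl ?_
  intro q hq
  rw [mem_antidiagonal] at hp hq
  exact h _ _ _ (by omega)

theorem Tri_sym (N : ℕ) (t : ℕ → ℕ → ℕ → ℚ) (h12 : ∀ a b c, t a b c = t b a c)
    (h23 : ∀ a b c, t a b c = t a c b) :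
    Tri N (fun a b c => ((a:ℚ) + b - 2 * c) * t a b c) = 0 := by
  have e1 : Tri N (fun a b c => (a:ℚ) * t a b c) = Tri N (fun a b c => (b:ℚ) * t a b c) := by
    rw [Tri_swap12]; exact Tri_congr N (fun a b c _ => by rw [h12])
  have e2 : Tri N (fun a b c => (b:ℚ) * t a b c) = Tri N (fun a b c => (c:ℚ) * t a b c) := by
    rw [Tri_swap23]; exact Tri_congr N (fun a b c _ => by rw [h23])
  have : Tri N (fun a b c => ((a:ℚ) + b - 2 * c) * t a b c) =
      Tri N (fun a b c => (a:ℚ) * t a b c) + Tri N (fun a b c => (b:ℚ) * t a b c)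
      + (-2) * Tri N (fun a b c => (c:ℚ) * t a b c) := by
    rw [← Tri_smul, ← Tri_add, ← Tri_add]
    exact Tri_congr N (fun a b c _ => by ring)
  rw [this, e1, e2]; ring

theorem sym_sum (m : ℕ) (s : ℚ) (v : ℕ → ℕ → ℚ) (hv : ∀ a b, v a b = v b a) :
    ∑ p ∈ antidiagonal m, ((p.1:ℚ) - s * p.2) * v p.1 p.2 =
      (1 - s) * m / 2 * ∑ p ∈ antidiagonal m, v p.1 p.2 := by
  have e : ∑ p ∈ antidiagonal m, ((p.1:ℚ) - s * p.2) * v p.1 p.2 =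
      ∑ p ∈ antidiagonal m, ((p.2:ℚ) - s * p.1) * v p.1 p.2 := by
    rw [← Finset.Nat.sum_antidiagonal_swap]
    refine Finset.sum_congr rfl ?_
    intro p _
    simp only [Prod.fst_swap, Prod.snd_swap]
    rw [hv]
  have e2 : ∑ p ∈ antidiagonal m, ((p.1:ℚ) - s * p.2) * v p.1 p.2 +
      ∑ p ∈ antidiagonal m, ((p.2:ℚ) - s * p.1) * v p.1 p.2 =
      (1 - s) * m * ∑ p ∈ antidiagonal m, v p.1 p.2 := by
    rw [← Finset.sum_add_distrib, Finset.mul_sum]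
    refine Finset.sum_congr rfl ?_
    intro p hp
    rw [mem_antidiagonal] at hp
    rw [← hp]; push_cast; ring
  linarith

theorem P_sum (N : ℕ) : ∑ p ∈ antidiagonal N, ((p.1:ℚ) - 2 * p.2) * (2 * p.2 + 1) =
    - (N * (N + 1) * (N + 3/2)) := by
  have key : ∀ n : ℕ, ∑ c ∈ Finset.range (n+1), ((N:ℚ) - 3 * c) * (2 * c + 1) =
      ((N:ℚ) * (n+1)^2 - (n * (n+1) * (2*n+1)) - 3 * n * (n+1)/2) := by
    intro n
    induction n with
    | zero => simp
    | succ n ih => rw [Finset.sum_range_succ, ih]; push_cast; ring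
  have := key N
  rw [← Finset.Nat.sum_antidiagonal_swap, Finset.Nat.sum_antidiagonal_eq_sum_range_succ_mk]
  rw [Finset.sum_congr rfl (g := fun c : ℕ => ((N:ℚ) - 3 * c) * (2 * c + 1))]
  · rw [this]; ring
  · intro c hc
    rw [Finset.mem_range] at hc
    simp only [Prod.swap]
    rw [Nat.cast_sub (by omega)]; ring

theorem abstract_rec (u : ℕ → ℚ) (v : ℕ → ℕ → ℚ) (t : ℕ → ℕ → ℕ → ℚ)
    (hv : ∀ a b, v a b = v b a) (h12 : ∀ a b c, t a b c = t b a c)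
    (h23 : ∀ a b c, t a b c = t a c b)
    (h1 : ∀ m, u (m+2) = 1/2 * ∑ p ∈ antidiagonal m, (v p.1 p.2 + u p.1 * u p.2))
    (h2 : ∀ k c, v (k+2) c = (2 * c + 1) * u (k+c+1) + 1/2 * ∑ p ∈ antidiagonal k,
      (t p.1 p.2 c + (u p.1 * v p.2 c + v p.1 c * u p.2)))
    (hs : ∀ N, v 0 (N+2) = (2 * N + 5) * u (N+1)) (hd : ∀ N, v 1 (N+1) = (2 * N + 3) * u (N+1))
    (h0 : u 0 = 0) (h1' : u 1 = 1/8) (N : ℕ) :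
    ((N:ℚ)+6) * u (N+4) = u (N+1) * ((2*N+6)*(2*N+5) + (2*N+3)^2 + (2*N+3)/8 + N*(N+1)*(N+3/2)) := by
  set S : ℕ → ℚ := fun m => ∑ p ∈ antidiagonal m, v p.1 p.2 with hS
  set Q : ℕ → ℚ := fun m => ∑ p ∈ antidiagonal m, u p.1 * u p.2 with hQ
  have hSQ : ∀ m, S m = 2 * u (m+2) - Q m := by
    intro m
    have := h1 m
    rw [Finset.sum_add_distrib] at this
    rw [this]; simp only [hS, hQ]; ring
  -- left side
  have hL : ∑ p ∈ antidiagonal N, ((p.1:ℚ) - 2 * p.2) * v (p.1+2) p.2 =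
      -((N:ℚ)+6)/2 * S (N+2) + (2*N+6) * v 0 (N+2) + (2*N+3) * v 1 (N+1) := by
    have e1 := sym_sum (N+2) 2 v hv
    have e2 : ∑ p ∈ antidiagonal (N+2), ((p.1:ℚ) - 2 * p.2 - 2) * v p.1 p.2 =
        -((N:ℚ)+6)/2 * S (N+2) := by
      have : ∑ p ∈ antidiagonal (N+2), ((p.1:ℚ) - 2 * p.2 - 2) * v p.1 p.2 =
        ∑ p ∈ antidiagonal (N+2), ((p.1:ℚ) - 2 * p.2) * v p.1 p.2 - 2 * S (N+2) := by
        simp only [hS]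
        rw [Finset.mul_sum, ← Finset.sum_sub_distrib]
        refine Finset.sum_congr rfl ?_
        intro p _; ring
      rw [this, e1]; simp only [hS]; push_cast; ring
    rw [Finset.Nat.sum_antidiagonal_succ, Finset.Nat.sum_antidiagonal_succ] at e2
    have e3 : ∑ p ∈ antidiagonal N, ((p.1:ℚ) - 2 * p.2) * v (p.1+2) p.2 =
      ∑ p ∈ antidiagonal N, (((p.1 + 1 + 1 : ℕ):ℚ) - 2 * p.2 - 2) * v (p.1+1+1) p.2 := by
      refine Finset.sum_congr rfl ?_
      intro p _; push_cast; ring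
    rw [e3]
    push_cast at e2 ⊢
    try simp only [zero_add] at e2
    rw [show (0:ℚ) - 2 * (N + 1 + 1) - 2 = -(2 * N + 6) by ring,
      show (1:ℚ) - 2 * (N + 1) - 2 = -(2 * N + 3) by ring] at e2
    linarith
  -- right side
  have hR : ∑ p ∈ antidiagonal N, ((p.1:ℚ) - 2 * p.2) * v (p.1+2) p.2 =
      u (N+1) * (- (N * (N + 1) * (N + 3/2))) +
      Tri N (fun a b c => ((a:ℚ) + b - 2 * c) * (u a * v b c)) := by
    have e1 : ∑ p ∈ antidiagonal N, ((p.1:ℚ) - 2 * p.2) * v (p.1+2) p.2 =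
        u (N+1) * (∑ p ∈ antidiagonal N, ((p.1:ℚ) - 2 * p.2) * (2 * p.2 + 1)) +
        Tri N (fun a b c => 1/2 * (((a:ℚ) + b - 2 * c) * t a b c + 
          (((a:ℚ) + b - 2 * c) * (u a * v b c) + ((a:ℚ) + b - 2 * c) * (v a c * u b)))) := by
      unfold Tri
      rw [Finset.mul_sum, ← Finset.sum_add_distrib]
      refine Finset.sum_congr rfl ?_
      intro p hp
      rw [mem_antidiagonal] at hp
      rw [h2, hp, mul_add, Finset.mul_sum, Finset.mul_sum]
      congr 1
      · ring
      refine Finset.sum_congr rfl ?_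
      intro q hq
      rw [mem_antidiagonal] at hq
      rw [← hq]; push_cast; ring
    rw [e1, P_sum, Tri_smul, Tri_add, Tri_add, Tri_sym N t h12 h23]
    have : Tri N (fun a b c => ((a:ℚ) + b - 2 * c) * (v a c * u b)) =
        Tri N (fun a b c => ((a:ℚ) + b - 2 * c) * (u a * v b c)) := by
      rw [Tri_swap12]
      exact Tri_congr N (fun a b c _ => by ring)
    rw [this]; ring
  have hT : Tri N (fun a b c => ((a:ℚ) + b - 2 * c) * (u a * v b c)) =
      ∑ p ∈ antidiagonal N, (3 * (p.1:ℚ) - N) / 2 * u p.1 * S p.2 := by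
    rw [Tri_assoc]
    refine Finset.sum_congr rfl ?_
    intro p hp
    rw [mem_antidiagonal] at hp
    have e := sym_sum p.2 2 v hv
    have : ∑ q ∈ antidiagonal p.2, ((p.1:ℚ) + q.1 - 2 * q.2) * (u p.1 * v q.1 q.2) =
      u p.1 * (∑ q ∈ antidiagonal p.2, ((q.1:ℚ) - 2 * q.2) * v q.1 q.2) +
      p.1 * u p.1 * ∑ q ∈ antidiagonal p.2, v q.1 q.2 := by
      rw [Finset.mul_sum, Finset.mul_sum, ← Finset.sum_add_distrib]
      refine Finset.sum_congr rfl ?_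
      intro q _; ring
    rw [this, e, ← hp]; simp only [hS]; push_cast; ring
  have hcub : ∑ p ∈ antidiagonal N, (3 * (p.1:ℚ) - N) / 2 * u p.1 * Q p.2 = 0 := by
    have e := Tri_sym N (fun a b c => u a * u b * u c) (fun a b c => by ring) (fun a b c => by ring)
    have e' : Tri N (fun a b c => ((a:ℚ) + b - 2 * c) * (u a * u b * u c)) =
       Tri N (fun a b c => ((c:ℚ) + b - 2 * a) * (u a * u b * u c)) := by
      rw [Tri_swap12, Tri_swap23, Tri_swap12]
      exact Tri_congr N (fun a b c _ => by ring)
    rw [e', Tri_assoc] at e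
    have : ∑ p ∈ antidiagonal N, (3 * (p.1:ℚ) - N) / 2 * u p.1 * Q p.2 =
      (-1/2) * ∑ p ∈ antidiagonal N, ∑ q ∈ antidiagonal p.2,
        ((q.2:ℚ) + q.1 - 2 * p.1) * (u p.1 * u q.1 * u q.2) := by
      rw [Finset.mul_sum]
      refine Finset.sum_congr rfl ?_
      intro p hp
      rw [mem_antidiagonal] at hp
      simp only [hQ]
      rw [Finset.mul_sum, Finset.mul_sum]
      refine Finset.sum_congr rfl ?_
      intro q hq
      rw [mem_antidiagonal] at hq
      rw [← hp, ← hq]; push_cast; ring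
    rw [this, e]; ring
  have hquad : ∑ p ∈ antidiagonal N, (3 * (p.1:ℚ) - N) * (u p.1 * u (p.2 + 2)) =
      ((N:ℚ)+6)/2 * Q (N+2) - (2*N+3) * (u 1 * u (N+1)) := by
    have e1 := sym_sum (N+2) 0 (fun a b => u a * u b) (fun a b => by ring)
    have e2 : ∑ p ∈ antidiagonal (N+2), (3 * (p.1:ℚ) - N) * (u p.1 * u p.2) =
        ((N:ℚ)+6)/2 * Q (N+2) := by
      have : ∑ p ∈ antidiagonal (N+2), (3 * (p.1:ℚ) - N) * (u p.1 * u p.2) =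
        3 * ∑ p ∈ antidiagonal (N+2), ((p.1:ℚ) - 0 * p.2) * (u p.1 * u p.2) 
          - N * Q (N+2) := by
        simp only [hQ]
        rw [Finset.mul_sum, Finset.mul_sum, ← Finset.sum_sub_distrib]
        refine Finset.sum_congr rfl ?_
        intro p hp
        ring
      rw [this, e1]; simp only [hQ]; push_cast; ring
    rw [Finset.Nat.sum_antidiagonal_succ', Finset.Nat.sum_antidiagonal_succ'] at e2
    simp only [h0, zero_add] at e2
    push_cast at e2
    have e3 : ∑ p ∈ antidiagonal N, (3 * (p.1:ℚ) - N) * (u p.1 * u (p.2 + 2)) =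
      ∑ p ∈ antidiagonal N, (3 * (p.1:ℚ) - N) * (u p.1 * u (p.2 + 1 + 1)) := rfl
    rw [e3]; linarith
  have hT2 : ∑ p ∈ antidiagonal N, (3 * (p.1:ℚ) - N) / 2 * u p.1 * S p.2 =
      ∑ p ∈ antidiagonal N, (3 * (p.1:ℚ) - N) * (u p.1 * u (p.2 + 2)) -
      ∑ p ∈ antidiagonal N, (3 * (p.1:ℚ) - N) / 2 * u p.1 * Q p.2 := by
    rw [← Finset.sum_sub_distrib]
    refine Finset.sum_congr rfl ?_
    intro p _
    rw [hSQ]; ring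
  rw [hR, hT, hT2, hcub, hquad, hs, hd, hSQ, h1'] at hL
  rw [show N + 2 + 2 = N + 4 by ring] at hL
  linarith

end

section

open Finset.HasAntidiagonal (antidiagonal mem_antidiagonal)

variable {C : List ℕ → ℚ}

theorem C_nil_zero (hC : IsNormalizedWitten C) : C [0] = 0 := by
  apply hC.zero
  rintro ⟨g, hg⟩
  simp at hg; omega

theorem W_rec (hC : IsNormalizedWitten C) (N : ℕ) :
    ((N:ℚ)+6) * W C [N+4] = W C [N+1] * ((2*N+6)*(2*N+5) + (2*N+3)^2 + (2*N+3)/8 + N*(N+1)*(N+3/2)) := by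
  refine abstract_rec (fun a => W C [a]) (fun a b => W C [a, b]) (fun a b c => W C [a, b, c])
    ?_ ?_ ?_ ?_ ?_ ?_ ?_ ?_ ?_ N
  · intro a b; exact W_perm hC (List.Perm.swap _ _ _)
  · intro a b c; exact W_perm hC (List.Perm.swap _ _ _)
  · intro a b c; exact W_perm hC (List.Perm.cons _ (List.Perm.swap _ _ _))
  · intro m
    rw [W_one hC, Finset.Nat.sum_antidiagonal_eq_sum_range_succ_mk]
  · intro k c
    rw [W_two hC, Finset.Nat.sum_antidiagonal_eq_sum_range_succ_mk]
  · intro N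
    show W C [0, N+2] = (2 * N + 5) * W C [N+1]
    by_cases h : IG [0, N+2]
    · rw [W_dvv hC _ _ h (by unfold T3; simp; omega)]
      have : (Finset.univ : Finset (Fin ([N+2] : List ℕ).length)) = {⟨0, by simp⟩} := by rfl
      rw [this, Finset.sum_singleton]
      simp
      left; ring
    · rw [W_zero hC h, W_zero hC]
      · simp
      · rintro ⟨g, hg⟩
        exact h ⟨g, by simp at hg ⊢; omega⟩
  · intro N
    show W C [1, N+1] = (2 * N + 3) * W C [N+1]
    by_cases h : IG [1, N+1]
    · rw [W_dvv hC _ _ h (by unfold T3; simp; omega)]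
      have : (Finset.univ : Finset (Fin ([N+1] : List ℕ).length)) = {⟨0, by simp⟩} := by rfl
      rw [this, Finset.sum_singleton]
      simp
      left; ring
    · rw [W_zero hC h, W_zero hC]
      · simp
      · rintro ⟨g, hg⟩
        exact h ⟨g, by simp at hg ⊢; omega⟩
  · show W C [0] = 0
    unfold W; rw [C_nil_zero hC, zero_mul]
  · show W C [1] = 1/8
    unfold W; rw [hC.init1, NF_eq (x := 1) (g := 1) (by simp [T3]) (by simp)]; norm_num

theorem C_rec (hC : IsNormalizedWitten C) (n : ℕ) :
    C [3*n+4] = C [3*n+1] * (((36*((n:ℚ)+1)^2-1)*(2*n+3)) / (36*(n+1)*(2*n+1)*(n+2))) := by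
  have h := W_rec hC (3*n)
  unfold W at h
  rw [NF_eq (x := 2*n+3) (g := n+2) (by simp [T3]; ring) (by simp; ring),
    NF_eq (x := 2*n+1) (g := n+1) (by simp [T3]; ring) (by simp; ring)] at h
  have e1 : 2 * n + 3 - 1 = 2*n+1+1 := by omega
  have e2 : 2 * n + 1 - 1 = 2*n := by omega
  rw [e1, e2, Nat.factorial_succ, Nat.factorial_succ] at h
  push_cast at h
  rw [show 2 * n + 3 = 2 * n + 1 + 2 by ring, show n + 2 = n + 1 + 1 by ring, pow_add, pow_add _ (n+1) 1] at h
  have h3 : (3:ℚ)^(2*n+1) ≠ 0 := by positivity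
  have h4 : (4:ℚ)^(n+1) ≠ 0 := by positivity
  have h5 : ((2*n).factorial : ℚ) ≠ 0 := by positivity
  set A := (3:ℚ)^(2*n+1)
  set B := (4:ℚ)^(n+1)
  set F := ((2*n).factorial : ℚ)
  have h' : (A * F / B) * ((3 * (n:ℚ) + 6) * C [3*n+4] * (9 * (2*n+2)*(2*n+1)/4)) =
    (A * F / B) * (C [3*n+1] * ((2 * (3 * (n:ℚ)) + 6) * (2 * (3 * n) + 5) + (2 * (3 * n) + 3) ^ 2 + (2 * (3 * n) + 3) / 8 + 3 * n * (3 * n + 1) * (3 * n + 3 / 2))) := by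
    rw [show (A * F / B) * ((3 * (n:ℚ) + 6) * C [3*n+4] * (9 * (2*n+2)*(2*n+1)/4)) =
      (3 * (n:ℚ) + 6) * (C [3 * n + 4] * (A * 3 ^ 2 * ((2 * n + 1 + 1) * ((2 * n + 1) * F)) / (B * 4 ^ 1))) by
        field_simp; ring]
    rw [h]; ring
  have hne : A * F / B ≠ 0 := by positivity
  have h'' := mul_left_cancel₀ hne h'
  rw [← mul_div_assoc, eq_div_iff (by positivity)]
  linear_combination (8 / 3) * h''

theorem C_closed (hC : IsNormalizedWitten C) (n : ℕ) :
    C [3*n+1] = 1/3 * (1 - 1/(2*((n:ℚ)+1))) * ∏ j ∈ Finset.range n, (1 - (1/6)^2 / ((j:ℚ)+1)^2) := by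
  induction n with
  | zero => simp [hC.init1]; norm_num
  | succ n ih =>
    rw [show 3 * (n+1) + 1 = 3 * n + 4 by ring, C_rec hC, ih, Finset.prod_range_succ]
    push_cast
    have : (2 * (n:ℚ) + 1) ≠ 0 := by positivity
    field_simp
    ring

theorem prod_tendsto : Filter.Tendsto (fun n : ℕ => ∏ j ∈ Finset.range n, (1 - ((1:ℝ)/6)^2 / ((j:ℝ)+1)^2))
    Filter.atTop (nhds (3 / Real.pi)) := by
  have h := Real.tendsto_euler_sin_prod (1/6)
  have h2 := h.const_mul (6 / Real.pi)
  have e : 6 / Real.pi * Real.sin (Real.pi * (1/6)) = 3 / Real.pi := by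
    rw [show Real.pi * (1/6) = Real.pi / 6 by ring, Real.sin_pi_div_six]; ring
  rw [e] at h2
  refine h2.congr ?_
  intro n
  have := Real.pi_ne_zero
  field_simp

theorem C_one_bound (hC : IsNormalizedWitten C) (n : ℕ) :
    (C [3*n+1] : ℝ) ≤ 1 / Real.pi * (1 - (47/100) / ((n:ℝ)+1)) := by
  set P : ℕ → ℝ := fun n => ∏ j ∈ Finset.range n, (1 - ((1:ℝ)/6)^2 / ((j:ℝ)+1)^2) with hP
  have hPpos : ∀ n, 0 < P n := by
    intro n
    refine Finset.prod_pos ?_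
    intro j _
    have : (1:ℝ) ≤ ((j:ℝ)+1)^2 := by
      have : (0:ℝ) ≤ j := by positivity
      nlinarith
    have h2 : ((1:ℝ)/6)^2 / ((j:ℝ)+1)^2 ≤ (1/6)^2 := div_le_self (by positivity) this
    linarith
  set R : ℕ → ℝ := fun n => (1 - 1 / (2 * ((n:ℝ)+1))) / (1 - (47/100) / ((n:ℝ)+1)) with hR
  have hRe : ∀ n : ℕ, R n = ((n:ℝ) + 1/2) / (n + 53/100) := by
    intro n
    have h1 : ((n:ℝ)+1) ≠ 0 := by positivity
    have h2 : ((n:ℝ) + 53/100) ≠ 0 := by positivity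
    have h3 : 1 - (47/100) / ((n:ℝ)+1) = (n + 53/100) / (n+1) := by field_simp; ring
    have h4 : 1 - 1 / (2 * ((n:ℝ)+1)) = (n+1/2) / (n+1) := by field_simp; ring
    simp only [hR]
    rw [h3, h4]; field_simp
  have hmono : Monotone (fun n => R n * P n) := by
    refine monotone_nat_of_le_succ ?_
    intro n
    have hp := hPpos n
    have e : P (n+1) = P n * (1 - ((1:ℝ)/6)^2 / ((n:ℝ)+1)^2) := by
      simp only [hP]; rw [Finset.prod_range_succ]
    rw [e, hRe, hRe]
    have key : ((n:ℝ) + 1/2) / (n + 53/100) ≤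
        (((n+1 : ℕ):ℝ) + 1/2) / (((n+1:ℕ):ℝ) + 53/100) * (1 - ((1:ℝ)/6)^2 / ((n:ℝ)+1)^2) := by
      push_cast
      rw [show (1 - ((1:ℝ)/6)^2 / ((n:ℝ)+1)^2) = (36 * ((n:ℝ)+1)^2 - 1) / (36 * ((n:ℝ)+1)^2) by
        field_simp; ring, div_mul_div_comm, div_le_div_iff₀ (by positivity) (by positivity)]
      have : (0:ℝ) ≤ n := by positivity
      nlinarith [pow_nonneg this 2, pow_nonneg this 3, pow_nonneg this 4]
    calc _ ≤ _ := mul_le_mul_of_nonneg_right key hp.le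
      _ = _ := by ring
  have hRt : Filter.Tendsto R Filter.atTop (nhds 1) := by
    have h1 : Filter.Tendsto (fun n : ℕ => 1 / ((n:ℝ)+1)) Filter.atTop (nhds 0) :=
      tendsto_one_div_add_atTop_nhds_zero_nat
    have h2 : Filter.Tendsto (fun n : ℕ => (1 - (1/2) * (1 / ((n:ℝ)+1))) / (1 - (47/100) * (1 / ((n:ℝ)+1))))
      Filter.atTop (nhds ((1 - (1/2) * 0) / (1 - (47/100) * 0))) := by
      refine Filter.Tendsto.div ?_ ?_ (by norm_num)
      · exact tendsto_const_nhds.sub (h1.const_mul _)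
      · exact tendsto_const_nhds.sub (h1.const_mul _)
    simp only [mul_zero, sub_zero, div_one] at h2
    refine h2.congr ?_
    intro n
    simp only [hR]
    congr 2
    · field_simp
    · field_simp
  have ht := hRt.mul prod_tendsto
  have hle := hmono.ge_of_tendsto ht n
  simp only [one_mul] at hle
  have hc := C_closed hC n
  have hc' : (C [3*n+1] : ℝ) = 1/3 * (1 - 1/(2*((n:ℝ)+1))) * P n := by
    rw [hc]; push_cast; rfl
  rw [hc']
  have hpos : 0 < 1 - (47/100) / ((n:ℝ)+1) := by
    have : (47/100) / ((n:ℝ)+1) ≤ 47/100 := div_le_self (by norm_num) (by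
      have : (0:ℝ) ≤ n := by positivity
      linarith)
    linarith
  have : (1 - 1/(2*((n:ℝ)+1))) = R n * (1 - (47/100) / ((n:ℝ)+1)) := by
    simp only [hR]; rw [div_mul_cancel₀ _ hpos.ne']
  rw [this]
  calc _ = (1/3 * (1 - (47/100) / ((n:ℝ)+1))) * (R n * P n) := by ring
    _ ≤ (1/3 * (1 - (47/100) / ((n:ℝ)+1))) * (3 / Real.pi) :=
      mul_le_mul_of_nonneg_left hle (by positivity)
    _ = _ := by ring

end

section

/-- majorant for `n = 1`. -/
def G1 (x : ℚ) : ℚ := 1 - (47/50) / (x + 1)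

/-- majorant for `n ≥ 2`. -/
def Gn (x n : ℚ) : ℚ := 1 - (9/10 - 3/5 * n / (x - n + 3)) / x

/-- constant for products. -/
def q1 : ℚ := 11/9 * (39/100)

theorem J4n (n g x : ℚ) (hx : x = 2 * g - 2 + n) (hn : 3 ≤ n) (hg : n ≤ g - 1) :
    (1 - 3 * (2/(3*(x-1)))) * Gn (x-1) (n-1) + 2/(3*(x-1)) * Gn (x-3) (n-1)
      + 2 * (2/(3*(x-1))) * (1 + 2/(3*(x-2))) * Gn (x-2) n
      + 1/(6*(x-1)*(x-2)) * (11/27 + (3*g-3) * (2 * q1 / ((2*g-4)*(2*g-5)))) ≤ Gn x n := by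
  obtain ⟨s, hs, rfl⟩ : ∃ s, 0 ≤ s ∧ n = 3 + s := ⟨n - 3, by linarith, by ring⟩
  obtain ⟨t, ht, rfl⟩ : ∃ t, 0 ≤ t ∧ g = 4 + s + t := ⟨g - 4 - s, by linarith, by ring⟩
  unfold Gn q1
  have hx0 : x = 9 + 3 * s + 2 * t := by rw [hx]; ring
  rw [show x - 1 - (3 + s - 1) + 3 = 9 + 2 * s + 2 * t by rw [hx0]; ring,
    show x - 3 - (3 + s - 1) + 3 = 7 + 2 * s + 2 * t by rw [hx0]; ring,
    show x - 2 - (3 + s) + 3 = 7 + 2 * s + 2 * t by rw [hx0]; ring,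
    show x - (3 + s) + 3 = 9 + 2 * s + 2 * t by rw [hx0]; ring,
    show x - 1 = 8 + 3 * s + 2 * t by rw [hx0]; ring,
    show x - 2 = 7 + 3 * s + 2 * t by rw [hx0]; ring,
    show x - 3 = 6 + 3 * s + 2 * t by rw [hx0]; ring,
    show 2 * (4 + s + t) - 4 = 4 + 2 * s + 2 * t by ring,
    show 2 * (4 + s + t) - 5 = 3 + 2 * s + 2 * t by ring, hx0]
  field_simp
  rw [← sub_nonneg]
  ring_nf
  positivity

end

section

theorem J2n_big (n g x : ℚ) (hx : x = 2 * g - 2 + n) (hn : 10 ≤ n) (hg : n ≤ 3 * (g - 1)) :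
    (1 - 2/(3*(x-1))) * Gn (x-1) (n-1)
      + 2/(3*(x-1)) * (1 + 1/(3*(x-2))) * (1 + 2/(3*(x-4))) * Gn (x-3) (n-1)
      + 1/(6*(x-1)*(x-2)) * (2 * (n-1) * q1 / (x-3) + n * (2 * q1 / ((2*g-4)*(2*g-5)))) ≤ Gn x n := by
  obtain ⟨s, hs, rfl⟩ : ∃ s, 0 ≤ s ∧ n = 10 + 3 * s := ⟨(n - 10)/3, by linarith, by ring⟩
  obtain ⟨t, ht, rfl⟩ : ∃ t, 0 ≤ t ∧ g = 13/3 + s + t := ⟨g - 13/3 - s, by linarith, by ring⟩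
  unfold Gn q1
  have hx0 : x = (50 + 15 * s + 6 * t)/3 := by rw [hx]; ring
  rw [show x - 1 - (10 + 3 * s - 1) + 3 = (29 + 6 * s + 6 * t)/3 by rw [hx0]; ring,
    show x - 3 - (10 + 3 * s - 1) + 3 = (23 + 6 * s + 6 * t)/3 by rw [hx0]; ring,
    show x - (10 + 3 * s) + 3 = (29 + 6 * s + 6 * t)/3 by rw [hx0]; ring,
    show x - 1 = (47 + 15 * s + 6 * t)/3 by rw [hx0]; ring,
    show x - 2 = (44 + 15 * s + 6 * t)/3 by rw [hx0]; ring,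
    show x - 3 = (41 + 15 * s + 6 * t)/3 by rw [hx0]; ring,
    show x - 4 = (38 + 15 * s + 6 * t)/3 by rw [hx0]; ring,
    show 2 * (13/3 + s + t) - 4 = (14 + 6 * s + 6 * t)/3 by ring,
    show 2 * (13/3 + s + t) - 5 = (11 + 6 * s + 6 * t)/3 by ring, hx0]
  field_simp
  rw [← sub_nonneg]
  ring_nf
  positivity

theorem J2n_small (n g x : ℚ) (hx : x = 2 * g - 2 + n)
    (hn : n = 3 ∨ n = 4 ∨ n = 5 ∨ n = 6 ∨ n = 7 ∨ n = 8 ∨ n = 9) (hg : 4 ≤ g) :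
    (1 - 2/(3*(x-1))) * Gn (x-1) (n-1)
      + 2/(3*(x-1)) * (1 + 1/(3*(x-2))) * (1 + 2/(3*(x-4))) * Gn (x-3) (n-1)
      + 1/(6*(x-1)*(x-2)) * (2 * (n-1) * q1 / (x-3) + n * (2 * q1 / ((2*g-4)*(2*g-5)))) ≤ Gn x n := by
  obtain ⟨t, ht, rfl⟩ : ∃ t, 0 ≤ t ∧ g = 4 + t := ⟨g - 4, by linarith, by ring⟩
  unfold Gn q1
  have hx0 : x = 6 + n + 2 * t := by rw [hx]; ring
  rw [show x - 1 - (n - 1) + 3 = 9 + 2 * t by rw [hx0]; ring,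
    show x - 3 - (n - 1) + 3 = 7 + 2 * t by rw [hx0]; ring,
    show x - n + 3 = 9 + 2 * t by rw [hx0]; ring,
    show x - 1 = 5 + n + 2 * t by rw [hx0]; ring,
    show x - 2 = 4 + n + 2 * t by rw [hx0]; ring,
    show x - 3 = 3 + n + 2 * t by rw [hx0]; ring,
    show x - 4 = 2 + n + 2 * t by rw [hx0]; ring,
    show 2 * (4 + t) - 4 = 4 + 2 * t by ring,
    show 2 * (4 + t) - 5 = 3 + 2 * t by ring, hx0]
  clear hx hx0
  rcases hn with rfl | rfl | rfl | rfl | rfl | rfl | rfl <;>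
  · field_simp
    rw [← sub_nonneg]
    ring_nf
    positivity

/-- case `g = 3`, no `Q` term -/
theorem J2n_three (n x : ℚ) (hx : x = 4 + n) (hn : n = 3 ∨ n = 4 ∨ n = 5 ∨ n = 6) :
    (1 - 2/(3*(x-1))) * Gn (x-1) (n-1)
      + 2/(3*(x-1)) * (1 + 1/(3*(x-2))) * (1 + 2/(3*(x-4))) * Gn (x-3) (n-1)
      + 1/(6*(x-1)*(x-2)) * (2 * (n-1) * q1 / (x-3)) ≤ Gn x n := by
  unfold Gn q1
  subst hx
  rcases hn with rfl | rfl | rfl | rfl <;> norm_num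

theorem J2two (g x : ℚ) (hx : x = 2 * g) (hg : g = 3 ∨ 4 ≤ g) :
    (1 - 2/(3*(x-1))) * G1 (x-1)
      + 2/(3*(x-1)) * (1 + 1/(3*(x-2))) * (1 + 2/(3*(x-4))) * G1 (x-3) ≤ Gn x 2 := by
  unfold Gn G1
  rcases hg with rfl | hg
  · subst hx; norm_num
  obtain ⟨t, ht, rfl⟩ : ∃ t, 0 ≤ t ∧ g = 4 + t := ⟨g - 4, by linarith, by ring⟩
  have hx0 : x = 8 + 2 * t := by rw [hx]; ring
  rw [show x - 1 + 1 = 8 + 2 * t by rw [hx0]; ring,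
    show x - 3 + 1 = 6 + 2 * t by rw [hx0]; ring,
    show x - 2 + 3 = 9 + 2 * t by rw [hx0]; ring,
    show x - 1 = 7 + 2 * t by rw [hx0]; ring,
    show x - 2 = 6 + 2 * t by rw [hx0]; ring,
    show x - 4 = 4 + 2 * t by rw [hx0]; ring, hx0]
  field_simp
  rw [← sub_nonneg]
  ring_nf
  positivity

end

section

theorem J3n_big (n g x : ℚ) (hx : x = 2 * g - 2 + n) (hn : 5 ≤ n) (hg : 2 * n ≤ 3 * (g - 1)) :
    (1 - 2 * (2/(3*(x-1)))) * Gn (x-1) (n-1)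
      + 2 * (2/(3*(x-1))) * (1 + 2/(3*(x-3))) * Gn (x-3) (n-1)
      + 1/(6*(x-1)*(x-2)) * (11/27 + (3*g-3) * (2 * q1 / ((2*g-4)*(2*g-5)))) ≤ Gn x n := by
  obtain ⟨s, hs, rfl⟩ : ∃ s, 0 ≤ s ∧ n = 5 + 3 * s := ⟨(n - 5)/3, by linarith, by ring⟩
  obtain ⟨t, ht, rfl⟩ : ∃ t, 0 ≤ t ∧ g = 13/3 + 2 * s + t := ⟨g - 13/3 - 2 * s, by linarith, by ring⟩
  unfold Gn q1
  have hx0 : x = (35 + 21 * s + 6 * t)/3 := by rw [hx]; ring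
  rw [show x - 1 - (5 + 3 * s - 1) + 3 = (29 + 12 * s + 6 * t)/3 by rw [hx0]; ring,
    show x - 3 - (5 + 3 * s - 1) + 3 = (23 + 12 * s + 6 * t)/3 by rw [hx0]; ring,
    show x - (5 + 3 * s) + 3 = (29 + 12 * s + 6 * t)/3 by rw [hx0]; ring,
    show x - 1 = (32 + 21 * s + 6 * t)/3 by rw [hx0]; ring,
    show x - 2 = (29 + 21 * s + 6 * t)/3 by rw [hx0]; ring,
    show x - 3 = (26 + 21 * s + 6 * t)/3 by rw [hx0]; ring,
    show 2 * (13/3 + 2 * s + t) - 4 = (14 + 12 * s + 6 * t)/3 by ring,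
    show 2 * (13/3 + 2 * s + t) - 5 = (11 + 12 * s + 6 * t)/3 by ring, hx0]
  field_simp
  rw [← sub_nonneg]
  ring_nf
  positivity

theorem J3n_small (n g x : ℚ) (hx : x = 2 * g - 2 + n)
    (hn : n = 3 ∨ n = 4) (hg : 4 ≤ g) :
    (1 - 2 * (2/(3*(x-1)))) * Gn (x-1) (n-1)
      + 2 * (2/(3*(x-1))) * (1 + 2/(3*(x-3))) * Gn (x-3) (n-1)
      + 1/(6*(x-1)*(x-2)) * (11/27 + (3*g-3) * (2 * q1 / ((2*g-4)*(2*g-5)))) ≤ Gn x n := by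
  obtain ⟨t, ht, rfl⟩ : ∃ t, 0 ≤ t ∧ g = 4 + t := ⟨g - 4, by linarith, by ring⟩
  unfold Gn q1
  have hx0 : x = 6 + n + 2 * t := by rw [hx]; ring
  rw [show x - 1 - (n - 1) + 3 = 9 + 2 * t by rw [hx0]; ring,
    show x - 3 - (n - 1) + 3 = 7 + 2 * t by rw [hx0]; ring,
    show x - n + 3 = 9 + 2 * t by rw [hx0]; ring,
    show x - 1 = 5 + n + 2 * t by rw [hx0]; ring,
    show x - 2 = 4 + n + 2 * t by rw [hx0]; ring,
    show x - 3 = 3 + n + 2 * t by rw [hx0]; ring,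
    show 2 * (4 + t) - 4 = 4 + 2 * t by ring,
    show 2 * (4 + t) - 5 = 3 + 2 * t by ring, hx0]
  clear hx hx0
  rcases hn with rfl | rfl <;>
  · field_simp
    rw [← sub_nonneg]
    ring_nf
    positivity

/-- case `g = 3`, `n = 3`, no `Q` term -/
theorem J3n_three (n x : ℚ) (hx : x = 7) (hn : n = 3) :
    (1 - 2 * (2/(3*(x-1)))) * Gn (x-1) (n-1)
      + 2 * (2/(3*(x-1))) * (1 + 2/(3*(x-3))) * Gn (x-3) (n-1)
      + 1/(6*(x-1)*(x-2)) * (11/27) ≤ Gn x n := by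
  unfold Gn; subst hx hn; norm_num

theorem J3two_three (x : ℚ) (hx : x = 6) :
    (1 - 2 * (2/(3*(x-1)))) * G1 (x-1)
      + 2 * (2/(3*(x-1))) * (1 + 2/(3*(x-3))) * G1 (x-3)
      + 1/(6*(x-1)*(x-2)) * (11/27) ≤ Gn x 2 := by
  unfold Gn G1; subst hx; norm_num

theorem J3two (g x : ℚ) (hx : x = 2 * g) (hg : 4 ≤ g) :
    (1 - 2 * (2/(3*(x-1)))) * G1 (x-1)
      + 2 * (2/(3*(x-1))) * (1 + 2/(3*(x-3))) * G1 (x-3)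
      + 1/(6*(x-1)*(x-2)) * (11/27 + (3*g-3) * (2 * q1 / ((2*g-4)*(2*g-5)))) ≤ Gn x 2 := by
  unfold Gn G1 q1
  obtain ⟨t, ht, rfl⟩ : ∃ t, 0 ≤ t ∧ g = 4 + t := ⟨g - 4, by linarith, by ring⟩
  have hx0 : x = 8 + 2 * t := by rw [hx]; ring
  rw [show x - 1 + 1 = 8 + 2 * t by rw [hx0]; ring,
    show x - 3 + 1 = 6 + 2 * t by rw [hx0]; ring,
    show x - 2 + 3 = 9 + 2 * t by rw [hx0]; ring,
    show x - 1 = 7 + 2 * t by rw [hx0]; ring,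
    show x - 2 = 6 + 2 * t by rw [hx0]; ring,
    show x - 3 = 5 + 2 * t by rw [hx0]; ring,
    show 2 * (4 + t) - 4 = 4 + 2 * t by ring,
    show 2 * (4 + t) - 5 = 3 + 2 * t by ring, hx0]
  field_simp
  rw [← sub_nonneg]
  ring_nf
  positivity

theorem J4two_three (x : ℚ) (hx : x = 6) :
    (1 - 3 * (2/(3*(x-1)))) * G1 (x-1) + 2/(3*(x-1)) * G1 (x-3)
      + 2 * (2/(3*(x-1))) * (1 + 2/(3*(x-2))) * Gn (x-2) 2
      + 1/(6*(x-1)*(x-2)) * (11/27) ≤ Gn x 2 := by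
  unfold Gn G1; subst hx; norm_num

theorem J4two (g x : ℚ) (hx : x = 2 * g) (hg : 4 ≤ g) :
    (1 - 3 * (2/(3*(x-1)))) * G1 (x-1) + 2/(3*(x-1)) * G1 (x-3)
      + 2 * (2/(3*(x-1))) * (1 + 2/(3*(x-2))) * Gn (x-2) 2
      + 1/(6*(x-1)*(x-2)) * (11/27 + (3*g-3) * (2 * q1 / ((2*g-4)*(2*g-5)))) ≤ Gn x 2 := by
  unfold Gn G1 q1
  obtain ⟨t, ht, rfl⟩ : ∃ t, 0 ≤ t ∧ g = 4 + t := ⟨g - 4, by linarith, by ring⟩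
  have hx0 : x = 8 + 2 * t := by rw [hx]; ring
  rw [show x - 1 + 1 = 8 + 2 * t by rw [hx0]; ring,
    show x - 3 + 1 = 6 + 2 * t by rw [hx0]; ring,
    show x - 2 - 2 + 3 = 7 + 2 * t by rw [hx0]; ring,
    show x - 2 + 3 = 9 + 2 * t by rw [hx0]; ring,
    show x - 1 = 7 + 2 * t by rw [hx0]; ring,
    show x - 2 = 6 + 2 * t by rw [hx0]; ring,
    show 2 * (4 + t) - 4 = 4 + 2 * t by ring,
    show 2 * (4 + t) - 5 = 3 + 2 * t by ring, hx0]
  field_simp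
  rw [← sub_nonneg]
  ring_nf
  positivity

end

section

theorem J5n_aux (n g x : ℚ) (hx : x = 2 * g - 2 + n) (hn : 3 ≤ n) (hg : 4 * n ≤ 3 * (g - 1)) :
    (1 - (3*(g-1)/n) * (2/(3*(x-1)))) * Gn (x-1) (n-1) 
      + (3*(g-1)/n - 4) * (2/(3*(x-1))) * Gn (x-1) (n+1)
      + 2 * (2/(3*(x-1))) * Gn (x-2) n
      + 2 * (2/(3*(x-1))) * (1 + 2/(3*(x-2))) * Gn (x-2) n
      + 1/(6*(x-1)*(x-2)) * (11/27 + (3*g-3) * (2 * q1 / ((2*g-4)*(2*g-5)))) ≤ Gn x n := by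
  obtain ⟨s, hs, rfl⟩ : ∃ s, 0 ≤ s ∧ n = 3 + 3 * s := ⟨(n - 3)/3, by linarith, by ring⟩
  obtain ⟨t, ht, rfl⟩ : ∃ t, 0 ≤ t ∧ g = 5 + 4 * s + t := ⟨g - 5 - 4 * s, by linarith, by ring⟩
  unfold Gn q1
  have hx0 : x = 11 + 11 * s + 2 * t := by rw [hx]; ring
  rw [show x - 1 - (3 + 3 * s - 1) + 3 = 11 + 8 * s + 2 * t by rw [hx0]; ring,
    show x - 1 - (3 + 3 * s + 1) + 3 = 9 + 8 * s + 2 * t by rw [hx0]; ring,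
    show x - 2 - (3 + 3 * s) + 3 = 9 + 8 * s + 2 * t by rw [hx0]; ring,
    show x - (3 + 3 * s) + 3 = 11 + 8 * s + 2 * t by rw [hx0]; ring,
    show x - 1 = 10 + 11 * s + 2 * t by rw [hx0]; ring,
    show x - 2 = 9 + 11 * s + 2 * t by rw [hx0]; ring,
    show 2 * (5 + 4 * s + t) - 4 = 6 + 8 * s + 2 * t by ring,
    show 2 * (5 + 4 * s + t) - 5 = 5 + 8 * s + 2 * t by ring, hx0]
  field_simp
  rw [← sub_nonneg]
  ring_nf
  positivity

theorem J5n_mono (n g x : ℚ) (hx : x = 2 * g - 2 + n) (hn : 3 ≤ n) (hg : 4 * n ≤ 3 * (g - 1)) :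
    Gn (x-1) (n-1) ≤ Gn (x-1) (n+1) := by
  obtain ⟨s, hs, rfl⟩ : ∃ s, 0 ≤ s ∧ n = 3 + 3 * s := ⟨(n - 3)/3, by linarith, by ring⟩
  obtain ⟨t, ht, rfl⟩ : ∃ t, 0 ≤ t ∧ g = 5 + 4 * s + t := ⟨g - 5 - 4 * s, by linarith, by ring⟩
  unfold Gn
  have hx0 : x = 11 + 11 * s + 2 * t := by rw [hx]; ring
  rw [show x - 1 - (3 + 3 * s - 1) + 3 = 11 + 8 * s + 2 * t by rw [hx0]; ring,
    show x - 1 - (3 + 3 * s + 1) + 3 = 9 + 8 * s + 2 * t by rw [hx0]; ring,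
    show x - 1 = 10 + 11 * s + 2 * t by rw [hx0]; ring]
  field_simp
  rw [← sub_nonneg]
  ring_nf
  positivity

/-- moving the parameter `e = d - 1`. -/
theorem J5_lin {e E w A B R G : ℚ} (he : e ≤ E) (hw : 0 ≤ w) (hAB : A ≤ B)
    (h : (1 - E * w) * A + (E - 4) * w * B + R ≤ G) :
    (1 - e * w) * A + (e - 4) * w * B + R ≤ G := by
  have h1 : 0 ≤ (E - e) * (w * (B - A)) :=
    mul_nonneg (by linarith) (mul_nonneg hw (by linarith))
  nlinarith

theorem J5n (n g x e : ℚ) (hx : x = 2 * g - 2 + n) (hn : 3 ≤ n) (he : 4 ≤ e)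
    (hg : n * e ≤ 3 * (g - 1)) :
    (1 - e * (2/(3*(x-1)))) * Gn (x-1) (n-1) 
      + (e - 4) * (2/(3*(x-1))) * Gn (x-1) (n+1)
      + (2 * (2/(3*(x-1))) * Gn (x-2) n
      + 2 * (2/(3*(x-1))) * (1 + 2/(3*(x-2))) * Gn (x-2) n
      + 1/(6*(x-1)*(x-2)) * (11/27 + (3*g-3) * (2 * q1 / ((2*g-4)*(2*g-5))))) ≤ Gn x n := by
  have hg4 : 4 * n ≤ 3 * (g - 1) := by nlinarith
  have h1 : 0 < x - 1 := by linarith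
  refine J5_lin (E := 3*(g-1)/n) ?_ (by positivity) (J5n_mono n g x hx hn hg4) ?_
  · rw [le_div_iff₀ (by linarith)]; linarith
  · have := J5n_aux n g x hx hn hg4
    linarith

theorem J5two_aux (g x : ℚ) (hx : x = 2 * g) (hg : 5 ≤ g) :
    (1 - (3*(g-1)/2) * (2/(3*(x-1)))) * G1 (x-1)
      + (3*(g-1)/2 - 4) * (2/(3*(x-1))) * Gn (x-1) 3
      + 2 * (2/(3*(x-1))) * Gn (x-2) 2
      + 2 * (2/(3*(x-1))) * (1 + 2/(3*(x-2))) * Gn (x-2) 2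
      + 1/(6*(x-1)*(x-2)) * (11/27 + (3*g-3) * (2 * q1 / ((2*g-4)*(2*g-5)))) ≤ Gn x 2 := by
  obtain ⟨t, ht, rfl⟩ : ∃ t, 0 ≤ t ∧ g = 5 + t := ⟨g - 5, by linarith, by ring⟩
  unfold Gn q1 G1
  have hx0 : x = 10 + 2 * t := by rw [hx]; ring
  rw [show x - 1 + 1 = 10 + 2 * t by rw [hx0]; ring,
    show x - 1 - 3 + 3 = 9 + 2 * t by rw [hx0]; ring,
    show x - 2 - 2 + 3 = 9 + 2 * t by rw [hx0]; ring,
    show x - 2 + 3 = 11 + 2 * t by rw [hx0]; ring,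
    show x - 1 = 9 + 2 * t by rw [hx0]; ring,
    show x - 2 = 8 + 2 * t by rw [hx0]; ring,
    show 2 * (5 + t) - 4 = 6 + 2 * t by ring,
    show 2 * (5 + t) - 5 = 5 + 2 * t by ring, hx0]
  field_simp
  rw [← sub_nonneg]
  ring_nf
  positivity

theorem J5two_mono (g x : ℚ) (hx : x = 2 * g) (hg : 5 ≤ g) :
    G1 (x-1) ≤ Gn (x-1) 3 := by
  obtain ⟨t, ht, rfl⟩ : ∃ t, 0 ≤ t ∧ g = 5 + t := ⟨g - 5, by linarith, by ring⟩
  unfold Gn G1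
  have hx0 : x = 10 + 2 * t := by rw [hx]; ring
  rw [show x - 1 + 1 = 10 + 2 * t by rw [hx0]; ring,
    show x - 1 - 3 + 3 = 9 + 2 * t by rw [hx0]; ring,
    show x - 1 = 9 + 2 * t by rw [hx0]; ring]
  field_simp
  rw [← sub_nonneg]
  ring_nf
  positivity

theorem J5two (g x e : ℚ) (hx : x = 2 * g) (hg : (g = 4 ∧ e = 4) ∨ 5 ≤ g) (he : 4 ≤ e)
    (hg : 2 * e ≤ 3 * (g - 1)) :
    (1 - e * (2/(3*(x-1)))) * G1 (x-1)
      + (e - 4) * (2/(3*(x-1))) * Gn (x-1) 3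
      + (2 * (2/(3*(x-1))) * Gn (x-2) 2
      + 2 * (2/(3*(x-1))) * (1 + 2/(3*(x-2))) * Gn (x-2) 2
      + 1/(6*(x-1)*(x-2)) * (11/27 + (3*g-3) * (2 * q1 / ((2*g-4)*(2*g-5))))) ≤ Gn x 2 := by
  rcases ‹(g = 4 ∧ e = 4) ∨ 5 ≤ g› with ⟨rfl, rfl⟩ | h5
  · subst hx; unfold Gn G1 q1; norm_num
  have h1 : 0 < x - 1 := by linarith
  refine J5_lin (E := 3*(g-1)/2) (by linarith) (by positivity) (J5two_mono g x hx h5) ?_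
  have := J5two_aux g x hx h5
  linarith

/-- F1, general. -/
theorem F1n (n g x : ℚ) (hx : x = 2 * g - 2 + n) (hn : 3 ≤ n) (hg : 1 ≤ g) :
    Gn (x-1) (n-1) ≤ Gn x n := by
  obtain ⟨s, hs, rfl⟩ : ∃ s, 0 ≤ s ∧ n = 3 + s := ⟨n - 3, by linarith, by ring⟩
  obtain ⟨t, ht, rfl⟩ : ∃ t, 0 ≤ t ∧ g = 1 + t := ⟨g - 1, by linarith, by ring⟩
  unfold Gn
  have hx0 : x = 3 + s + 2 * t := by rw [hx]; ring
  rw [show x - 1 - (3 + s - 1) + 3 = 3 + 2 * t by rw [hx0]; ring,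
    show x - (3 + s) + 3 = 3 + 2 * t by rw [hx0]; ring,
    show x - 1 = 2 + s + 2 * t by rw [hx0]; ring, hx0]
  field_simp
  rw [← sub_nonneg]
  ring_nf
  positivity

theorem F1two (g x : ℚ) (hx : x = 2 * g) (hg : 1 ≤ g) :
    G1 (x-1) ≤ Gn x 2 := by
  obtain ⟨t, ht, rfl⟩ : ∃ t, 0 ≤ t ∧ g = 1 + t := ⟨g - 1, by linarith, by ring⟩
  unfold Gn G1
  have hx0 : x = 2 + 2 * t := by rw [hx]; ring
  rw [show x - 1 + 1 = 2 + 2 * t by rw [hx0]; ring,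
    show x - 2 + 3 = 3 + 2 * t by rw [hx0]; ring, hx0]
  field_simp
  rw [← sub_nonneg]
  ring_nf
  positivity

/-- F2. -/
theorem Gn_le_one (n g x : ℚ) (hx : x = 2 * g - 2 + n) (hn : 2 ≤ n) (hg : n ≤ 3 * (g - 1)) :
    Gn x n ≤ 1 := by
  unfold Gn
  have h0 : 0 < x := by linarith
  have h1 : 0 < x - n + 3 := by linarith
  have : 3/5 * n / (x - n + 3) ≤ 9/10 := by
    rw [div_le_iff₀ h1]; linarith
  have : 0 ≤ (9/10 - 3/5 * n / (x - n + 3)) / x := by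
    apply div_nonneg _ h0.le; linarith
  linarith

end

section

/-- the majorant -/
def Gf (x : ℚ) (n : ℕ) : ℚ := if n = 1 then G1 x else Gn x n

section
variable {C : List ℕ → ℚ}

theorem T3_cast (l : List ℕ) : (T3 l : ℚ) = 2 * (l.sum : ℚ) + l.length := by
  unfold T3; rw [Nat.cast_add, Nat.cast_mul]; norm_num

theorem string_le (hC : IsNormalizedWitten C) (s : List ℕ) (g : ℕ) (y M : ℚ)
    (hg : s.sum + 3 = 3 * g + (s.length + 1)) (hy : y + 2 = 2 * g + s.length) (hy1 : 1 ≤ y)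
    (h1 : ∀ i ∈ s, 1 ≤ i)
    (hM : ∀ j : Fin s.length, C (s.set j (s.get j - 1)) ≤ M) :
    C (0 :: s) ≤ (1 + 2/(3*y)) * M := by
  have hgq : (s.sum : ℚ) + 3 = 3 * g + (s.length + 1) := by exact_mod_cast hg
  have hT : (T3 s : ℚ) = 3 * y + 2 := by rw [T3_cast]; linarith
  have hT6 : 6 ≤ T3 (0 :: s) := by
    rw [T3_cons]
    have : (5:ℚ) ≤ T3 s := by rw [hT]; linarith
    have : 5 ≤ T3 s := by exact_mod_cast this
    omega
  rw [hC.string s ⟨g, by simpa using hg⟩ hT6]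
  have hd : (0:ℚ) < (T3 s : ℚ) - 2 := by rw [hT]; linarith
  calc _ ≤ ∑ j : Fin s.length, (2 * (s.get j : ℚ) + 1) / ((T3 s : ℚ) - 2) * M := by
        apply Finset.sum_le_sum
        intro j _
        rw [if_pos (h1 _ (List.get_mem _ _))]
        exact mul_le_mul_of_nonneg_left (hM j) (by positivity)
    _ = (1 + 2/(3*y)) * M := by
        rw [← Finset.sum_mul, ← Finset.sum_div, sum_weight, hT]
        congr 1
        field_simp
        ring

theorem string00_le (hC : IsNormalizedWitten C) (s : List ℕ) (g : ℕ) (y M : ℚ)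
    (hg : s.sum + 3 = 3 * g + (s.length + 2)) (hy : y + 2 = 2 * g + (s.length + 1)) (hy1 : 1 ≤ y)
    (h1 : ∀ i ∈ s, 1 ≤ i)
    (hM : ∀ j : Fin s.length, C (0 :: s.set j (s.get j - 1)) ≤ M) :
    C (0 :: 0 :: s) ≤ (1 + 1/(3*y)) * M := by
  have hgq : (s.sum : ℚ) + 3 = 3 * g + (s.length + 2) := by exact_mod_cast hg
  have hT : (T3 s : ℚ) = 3 * y + 1 := by rw [T3_cast]; linarith
  have hT' : T3 (0 :: s) = T3 s + 1 := by rw [T3_cons]; omega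
  have hT6 : 6 ≤ T3 (0 :: 0 :: s) := by
    rw [T3_cons, hT']
    have : (4:ℚ) ≤ T3 s := by rw [hT]; linarith
    have : 4 ≤ T3 s := by exact_mod_cast this
    omega
  rw [hC.string (0 :: s) ⟨g, by simpa using hg⟩ hT6, hT']
  push_cast
  have hd : (0:ℚ) < (T3 s : ℚ) + 1 - 2 := by rw [hT]; linarith
  refine le_of_eq_of_le (Fin.sum_univ_succ (n := s.length) _) ?_
  calc _ ≤ 0 + ∑ j : Fin s.length, (2 * (s.get j : ℚ) + 1) / ((T3 s : ℚ) + 1 - 2) * M := by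
        apply add_le_add
        · simp
        apply Finset.sum_le_sum
        intro j _
        have e : (0 :: s).get j.succ = s.get j := rfl
        rw [e, if_pos (h1 _ (List.get_mem _ _))]
        exact mul_le_mul_of_nonneg_left (hM j) (by positivity)
    _ = (1 + 1/(3*y)) * M := by
        rw [← Finset.sum_mul, ← Finset.sum_div, sum_weight, hT, zero_add,
          show 3 * y + 1 + 1 - 2 = 3 * y by ring]
        congr 1
        have : y ≠ 0 := by linarith
        field_simp

theorem first_le (d : ℕ) (r : List ℕ) (g : ℕ) (x M : ℚ) (hd : 1 ≤ d)
    (hg : d + r.sum + 3 = 3 * g + (r.length + 1)) (hx : x + 2 = 2 * g + (r.length + 1))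
    (hx1 : 1 < x)
    (hM : ∀ j : Fin r.length, C (r.set j (d + r.get j - 1)) ≤ M) :
    (∑ j : Fin r.length,
        if 1 ≤ d + r.get j then
          (2 * (r.get j : ℚ) + 1) / ((T3 (d :: r) : ℚ) - 3) *
            C (r.set j.val (d + r.get j - 1))
        else 0) ≤ (1 - ((d:ℚ) - 1) * (2/(3*(x-1)))) * M := by
  have hgq : (d:ℚ) + r.sum + 3 = 3 * g + (r.length + 1) := by exact_mod_cast hg
  have hT : (T3 r : ℚ) = 3 * x - 2 * d - 1 := by rw [T3_cast]; linarith
  have hT' : (T3 (d :: r) : ℚ) = 3 * x := by rw [T3_cons]; push_cast; rw [hT]; ring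
  have hd : (0:ℚ) < x - 1 := by linarith
  rw [hT']
  calc _ ≤ ∑ j : Fin r.length, (2 * (r.get j : ℚ) + 1) / (3 * x - 3) * M := by
        apply Finset.sum_le_sum
        intro j _
        rw [if_pos (by omega)]
        apply mul_le_mul_of_nonneg_left (hM j)
        apply div_nonneg (by positivity) (by linarith)
    _ = _ := by
        rw [← Finset.sum_mul, ← Finset.sum_div, sum_weight, hT,
          show 3 * x - 3 = 3 * (x-1) by ring]
        congr 1
        field_simp
        ring

/-- inductive hypothesis -/
def Bnd (C : List ℕ → ℚ) (q : ℚ) (N : ℕ) : Prop :=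
  ∀ (l : List ℕ) (g : ℕ) (x : ℚ), l ≠ [] → (∀ i ∈ l, 1 ≤ i) → l.sum + 3 = 3 * g + l.length →
    x + 2 = 2 * g + l.length → 2 * g + l.length < N + 2 → C l ≤ q * Gf x l.length

theorem sum_ge (k : ℕ) (l : List ℕ) (h : ∀ i ∈ l, k ≤ i) : k * l.length ≤ l.sum := by
  have := List.card_nsmul_le_sum l k h
  simpa [mul_comm] using this

theorem Gf_le_one {l : List ℕ} {g : ℕ} {x : ℚ} (hne : l ≠ []) (h : ∀ i ∈ l, 2 ≤ i)
    (hg : l.sum + 3 = 3 * g + l.length) (hx : x + 2 = 2 * g + l.length) : Gf x l.length ≤ 1 := by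
  have h0 := sum_ge 2 l h
  have hl : 0 < l.length := List.length_pos_iff.2 hne
  have h1 : l.length + 3 ≤ 3 * g := by omega
  have h1q : (l.length : ℚ) + 3 ≤ 3 * g := by exact_mod_cast h1
  have hlq : (1:ℚ) ≤ l.length := by exact_mod_cast hl
  unfold Gf
  split_ifs with hn
  · unfold G1
    have : 0 ≤ 47/50 / (x + 1) := by apply div_nonneg (by norm_num); linarith
    linarith
  · have : 2 ≤ l.length := by omega
    exact Gn_le_one _ g _ (by linarith) (by exact_mod_cast this) (by linarith)

theorem le_q (hC : IsNormalizedWitten C) {q : ℚ} {N : ℕ} (hq : 318/1000 ≤ q) (hB : Bnd C q N) :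
    ∀ (k : ℕ) (l : List ℕ) (g : ℕ), l.length = k → l ≠ [] → (∀ i ∈ l, 1 ≤ i) →
    l.sum + 3 = 3 * g + l.length → 2 * g + l.length < N + 2 → C l ≤ q := by
  intro k
  induction k with
  | zero => intro l g hk hne; exact absurd (List.length_eq_zero_iff.1 hk) hne
  | succ k ih =>
    intro l g hk hne h1 hg hN
    by_cases hmem : 1 ∈ l
    · have hp := List.perm_cons_erase hmem
      rw [hC.symm hp]
      have hs : l.sum = 1 + (l.erase 1).sum := by rw [hp.sum_eq]; simp
      have hl : l.length = (l.erase 1).length + 1 := by rw [hp.length_eq]; simp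
      by_cases he : l.erase 1 = []
      · rw [he, hC.init1]; linarith
      · rw [hC.dilaton _ he]
        exact ih _ g (by omega) he (fun i hi => h1 i (List.mem_of_mem_erase hi)) (by omega) (by omega)
    · have h2 : ∀ i ∈ l, 2 ≤ i := by
        intro i hi
        have := h1 i hi
        have : i ≠ 1 := fun h => hmem (h ▸ hi)
        omega
      have := hB l g (2 * g + l.length - 2) hne h1 hg (by ring) hN
      have h3 := Gf_le_one hne h2 hg (x := 2 * g + l.length - 2) (by ring)
      nlinarith

theorem set_pred {s : List ℕ} (h : ∀ i ∈ s, 2 ≤ i) (j : Fin s.length) :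
    (∀ i ∈ s.set j (s.get j - 1), 1 ≤ i) ∧ (s.set j (s.get j - 1)).sum + 1 = s.sum := by
  have hj := h _ (List.get_mem s j)
  constructor
  · intro i hi
    rcases List.mem_or_eq_of_mem_set hi with hi | hi
    · have := h i hi; omega
    · omega
  · have := sum_set_add s j j.2 (s.get j - 1)
    simp only [List.get_eq_getElem] at *
    omega

theorem set_ne {s : List ℕ} (hne : s ≠ []) (j v : ℕ) : s.set j v ≠ [] := by
  simpa using hne

theorem Z1 (hC : IsNormalizedWitten C) {q : ℚ} {N : ℕ} (hB : Bnd C q N)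
    (s : List ℕ) (g : ℕ) (y : ℚ) (hne : s ≠ []) (h2 : ∀ i ∈ s, 2 ≤ i)
    (hg : s.sum + 3 = 3 * g + (s.length + 1)) (hy : y + 2 = 2 * g + s.length)
    (hN : 2 * g + s.length < N + 2) :
    C (0 :: s) ≤ (1 + 2/(3*y)) * (q * Gf y s.length) := by
  have h0 := sum_ge 2 s h2
  have hl : 0 < s.length := List.length_pos_iff.2 hne
  have hgl : 3 ≤ 2 * g + s.length := by omega
  have hglq : (3:ℚ) ≤ 2 * g + s.length := by exact_mod_cast hgl
  refine string_le hC s g y _ hg hy (by linarith) (fun i hi => by have := h2 i hi; omega) ?_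
  intro j
  obtain ⟨ha, hb⟩ := set_pred h2 j
  have := hB _ g y (set_ne hne _ _) ha (by rw [List.length_set]; omega)
    (by rw [List.length_set]; exact hy) (by rw [List.length_set]; omega)
  rwa [List.length_set] at this

theorem C_02 (hC : IsNormalizedWitten C) : C [0, 2] ≤ 5/18 := by
  have := string_le hC [2] 1 1 (1/6) (by simp) (by norm_num) (by norm_num) (by simp) (by
    intro j
    fin_cases j
    simp [hC.init1])
  norm_num at this ⊢
  exact this

theorem U (hC : IsNormalizedWitten C) {q : ℚ} {N : ℕ} (hq : 318/1000 ≤ q) (hB : Bnd C q N)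
    (a : ℕ) (s : List ℕ) (h2 : ∀ i ∈ s, 2 ≤ i) (g : ℕ)
    (hg : a + s.sum + 3 = 3 * g + (s.length + 1)) 
    (hN : 2 * g + (s.length + 1) < N + 2) : C (a :: s) ≤ 11/9 * q := by
  rcases Nat.eq_zero_or_pos a with rfl | ha
  · by_cases hne : s = []
    · subst hne; rw [C_nil_zero hC]; linarith
    have h0 := sum_ge 2 s h2
    have hl : 0 < s.length := List.length_pos_iff.2 hne
    by_cases h5 : 5 ≤ 2 * g + s.length
    · have h5q : (5:ℚ) ≤ 2 * g + s.length := by exact_mod_cast h5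
      have := string_le hC s g (2 * g + s.length - 2) q (by omega) (by ring) (by linarith)
        (fun i hi => by have := h2 i hi; omega) (by
          intro j
          obtain ⟨ha, hb⟩ := set_pred h2 j
          exact le_q hC hq hB _ _ g rfl (set_ne hne _ _) ha (by rw [List.length_set]; omega)
            (by rw [List.length_set]; omega))
      refine this.trans ?_
      apply mul_le_mul_of_nonneg_right _ (by linarith)
      have : 2/(3*(2 * (g:ℚ) + s.length - 2)) ≤ 2/9 := by
        apply div_le_div_of_nonneg_left <;> linarith
      linarith
    · have hl1 : s.length = 1 := by omega
      obtain ⟨b, rfl⟩ := List.length_eq_one_iff.1 hl1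
      have hb : b = 2 := by simp at *; omega
      subst hb
      have := C_02 hC
      linarith
  · have := le_q hC hq hB _ (a :: s) g rfl (by simp) (by
      intro i hi
      rcases List.mem_cons.1 hi with rfl | hi
      · exact ha
      · have := h2 i hi; omega) (by simp; omega) (by simp; omega)
    linarith
end

end

section

theorem coef_eq (p q : ℕ) : ((p.factorial : ℚ) * q.factorial) / (6 * ((p+q+2).factorial : ℚ)) =
    1 / (6 * ((p:ℚ)+q+2) * ((p:ℚ)+q+1) * ((p+q).choose p : ℚ)) := by
  have h := Nat.add_choose_mul_factorial_mul_factorial p q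
  have hq : ((p+q).choose p : ℚ) * p.factorial * q.factorial = (p+q).factorial := by
    rw [Nat.choose_symm_add]
    exact_mod_cast h
  have h2 : ((p+q+2).factorial : ℚ) = ((p:ℚ)+q+2) * (((p:ℚ)+q+1) * (p+q).factorial) := by
    rw [show p+q+2 = (p+q+1)+1 by ring, Nat.factorial_succ, Nat.factorial_succ]; push_cast; ring
  have c0 : (0:ℚ) < (p+q).choose p := by exact_mod_cast Nat.choose_pos (by omega)
  have f1 : (0:ℚ) < p.factorial := by exact_mod_cast Nat.factorial_pos p
  have f2 : (0:ℚ) < q.factorial := by exact_mod_cast Nat.factorial_pos q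
  rw [h2, ← hq]
  field_simp

theorem choose_two_le (n : ℕ) : ∀ k, 2 ≤ k → k + 2 ≤ n → n.choose 2 ≤ n.choose k := by
  induction n with
  | zero => intro k h1 h2; omega
  | succ n ih =>
    intro k h1 h2
    obtain ⟨k, rfl⟩ : ∃ m, k = m + 1 := ⟨k - 1, by omega⟩
    rcases Nat.eq_or_lt_of_le h1 with h | h
    · rw [← h]
    rcases Nat.eq_or_lt_of_le h2 with h' | h'
    · have : n + 1 - (k + 1) = 2 := by omega
      rw [← Nat.choose_symm (n := n + 1) (k := k + 1) (by omega), this]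
    rw [Nat.choose_succ_succ' n k, Nat.choose_succ_succ' n 1, Nat.choose_one_right]
    have h3 := ih (k+1) (by omega) (by omega)
    have h4 : n ≤ n.choose k := by
      rcases Nat.eq_or_lt_of_le (show 2 ≤ k by omega) with h5 | h5
      · have := ih 2 le_rfl (by omega)
        rw [← h5, Nat.choose_two_right]
        rw [Nat.le_div_iff_mul_le (by norm_num)]
        obtain ⟨m, rfl⟩ : ∃ m, n = m + 3 := ⟨n - 3, by omega⟩
        simp
      · have := ih k (by omega) (by omega)
        refine le_trans ?_ this
        rw [Nat.choose_two_right]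
        rw [Nat.le_div_iff_mul_le (by norm_num)]
        obtain ⟨m, rfl⟩ : ∃ m, n = m + 3 := ⟨n - 3, by omega⟩
        simp
    norm_num at *
    omega

theorem choose_mul_le (A B i j : ℕ) : A.choose i * B.choose j ≤ (A + B).choose (i + j) := by
  rw [Nat.add_choose_eq]
  exact Finset.single_le_sum (f := fun p : ℕ × ℕ => A.choose p.1 * B.choose p.2)
    (fun _ _ => Nat.zero_le _) (a := (i, j)) (by simp)

theorem choose_lower (m i g g' : ℕ) (h1 : 2 ≤ g') (h2 : g' + 2 ≤ g) :
    (m.choose i : ℚ) * ((2*(g:ℚ)-4)*(2*g-5)/2) ≤ ((m + (2*g-4)).choose (i + (2*g'-2)) : ℚ) := by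
  have e1 := choose_mul_le m (2*g-4) i (2*g'-2)
  have e2 := choose_two_le (2*g-4) (2*g'-2) (by omega) (by omega)
  have e3 : m.choose i * (2*g-4).choose 2 ≤ (m + (2*g-4)).choose (i + (2*g'-2)) :=
    (Nat.mul_le_mul_left _ e2).trans e1
  have e4 : ((2*g-4).choose 2 : ℚ) = (2*(g:ℚ)-4)*(2*g-5)/2 := by
    rw [Nat.cast_choose_two]
    rw [Nat.cast_sub (by omega)]; push_cast; ring
  rw [← e4]
  exact_mod_cast e3

theorem sum_inv_choose (m : ℕ) :
    ∑ I : Finset (Fin m), (1:ℚ) / (m.choose I.card : ℚ) = m + 1 := by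
  have := Finset.sum_powerset_apply_card (α := ℚ) (fun k => (1:ℚ) / (m.choose k : ℚ)) (x := (Finset.univ : Finset (Fin m)))
  rw [Finset.powerset_univ] at this
  rw [this, Finset.card_univ, Fintype.card_fin]
  rw [Finset.sum_congr rfl (g := fun _ => (1:ℚ))]
  · simp
  · intro k hk
    have : (0:ℚ) < m.choose k := by
      exact_mod_cast Nat.choose_pos (by have := Finset.mem_range.1 hk; omega)
    simp; field_simp

theorem sum_card_one (m : ℕ) :
    ∑ I : Finset (Fin m), (if I.card = 1 then (1:ℚ) else 0) = m := by
  rw [Finset.sum_ite, Finset.sum_const_zero, add_zero, Finset.sum_const, nsmul_eq_mul, mul_one]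
  rw [← Finset.powerset_univ, ← Finset.powersetCard_eq_filter, Finset.card_powersetCard]
  simp

theorem sum_card_compl_one (m : ℕ) :
    ∑ I : Finset (Fin m), (if Iᶜ.card = 1 then (1:ℚ) else 0) = m := by
  rw [← sum_card_one m]
  exact Fintype.sum_equiv (Equiv.mk compl compl compl_compl compl_compl) _ _ (fun _ => rfl)

/-- the Q-quantity -/
def Qg (g : ℕ) : ℚ := if 4 ≤ g then 2 * q1 / ((2*(g:ℚ)-4)*(2*g-5)) else 0

theorem Qg_nonneg (g : ℕ) : 0 ≤ Qg g := by
  unfold Qg q1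
  split_ifs with h
  · have : (4:ℚ) ≤ g := by exact_mod_cast h
    apply div_nonneg (by norm_num)
    apply mul_nonneg <;> linarith
  · exact le_rfl

/-- one summand of the split sum -/
def sterm (C : List ℕ → ℚ) (d a b : ℕ) (r : List ℕ) (I : Finset (Fin r.length)) : ℚ :=
  if 3 ∣ (2 * (a + (select r I).sum) + (1 + (select r I).length)) then
      ((XN (a :: select r I) - 1).factorial : ℚ) *
        ((XN (b :: select r Iᶜ) - 1).factorial : ℚ) /
        (6 * ((XN (d :: r) - 1).factorial : ℚ)) *
        C (a :: select r I) * C (b :: select r Iᶜ)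
    else 0

section
variable {C : List ℕ → ℚ}

theorem XN_of (l : List ℕ) (g x : ℕ) (hg : l.sum + 3 = 3 * g + l.length)
    (hx : x + 2 = 2 * g + l.length) : XN l = x := by
  apply XN_eq; unfold T3; omega

/-- the general structure of a summand: it vanishes or has the given data -/
theorem sterm_le (hC : IsNormalizedWitten C) {q : ℚ} {N : ℕ} (hq : 318/1000 ≤ q)
    (hq' : q ≤ 319/1000) (hB : Bnd C q N) (d a b : ℕ) (r : List ℕ) (I : Finset (Fin r.length))
    (hab : a + b + 2 = d) (h2 : ∀ i ∈ r, 2 ≤ i) (g : ℕ) (x : ℚ)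
    (hg : d + r.sum + 3 = 3 * g + (r.length + 1)) (hx : x + 2 = 2 * g + (r.length + 1))
    (hN : 2 * g + (r.length + 1) ≤ N + 2) (P : ℚ) (hP : 0 ≤ P)
    (h : ∀ g' g'' : ℕ, 1 ≤ g' → 1 ≤ g'' → g' + g'' = g →
      a + (select r I).sum + 3 = 3 * g' + (I.card + 1) →
      b + (select r Iᶜ).sum + 3 = 3 * g'' + (Iᶜ.card + 1) →
      C (a :: select r I) ≤ 11/9 * q → C (b :: select r Iᶜ) ≤ 11/9 * q →
      (g' = 1 ∨ g'' = 1) →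
      1 / ((r.length + (2*g-4)).choose (I.card + (2*g'-2)) : ℚ) *
        (C (a :: select r I) * C (b :: select r Iᶜ)) ≤ q * P) :
    sterm C d a b r I ≤ q / (6 * (x-1) * (x-2)) * (P + Qg g * (1 / (r.length.choose I.card : ℚ))) := by
  have hl1 := select_length r I
  have hl2 := select_length r Iᶜ
  have hl := select_length_compl r I
  have hs := select_sum_compl r I
  have hs1 := sum_ge 2 (select r I) (fun i hi => h2 i (select_mem hi))
  have hs2 := sum_ge 2 (select r Iᶜ) (fun i hi => h2 i (select_mem hi))
  have hs0 := sum_ge 2 r h2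
  have hg2 : 1 ≤ g := by omega
  have hg2q : (1:ℚ) ≤ g := by exact_mod_cast hg2
  have hQ := Qg_nonneg g
  have hQ2 : 0 ≤ Qg g * (1 / (r.length.choose I.card : ℚ)) := mul_nonneg hQ (by positivity)
  have hzero : 2 ≤ g → 0 ≤ q / (6 * (x-1) * (x-2)) * (P + Qg g * (1 / (r.length.choose I.card : ℚ))) := by
    intro h
    have hh : (2:ℚ) ≤ g := by exact_mod_cast h
    have hr : (0:ℚ) ≤ r.length := by positivity
    apply mul_nonneg _ (by linarith)
    apply div_nonneg (by linarith)
    apply mul_nonneg <;> linarith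
  have hxn : 0 ≤ q / (6 * (x-1) * (x-2)) * (P + Qg g * (1 / (r.length.choose I.card : ℚ))) := by
    rcases Nat.lt_or_ge g 2 with h | h
    · have hg1 : g = 1 := by omega
      have : r.length = 0 := by omega
      have hx1 : x = 1 := by rw [this, hg1] at hx; norm_num at hx; linarith
      rw [hx1]; simp
    · exact hzero h
  unfold sterm
  split_ifs with h3
  swap
  · exact hxn
  by_cases hI1 : IG (a :: select r I)
  swap
  · rw [hC.zero hI1]; simpa using hxn
  by_cases hI2 : IG (b :: select r Iᶜ)
  swap
  · rw [hC.zero hI2]; simpa using hxn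
  obtain ⟨g', hg'⟩ := hI1
  obtain ⟨g'', hg''⟩ := hI2
  have hg1' := hg'
  have hg1'' := hg''
  simp only [List.sum_cons, List.length_cons, hl1, hl2] at hg' hg''
  have hgg : g' + g'' = g := by omega
  have hp1 : 1 ≤ g' := by omega
  have hp2 : 1 ≤ g'' := by omega
  have hU1 := U hC hq hB a (select r I) (fun i hi => h2 i (select_mem hi)) g' (by omega) (by omega)
  have hU2 := U hC hq hB b (select r Iᶜ) (fun i hi => h2 i (select_mem hi)) g'' (by omega) (by omega)
  have hn1 := hC.nn a (select r I)
  have hn2 := hC.nn b (select r Iᶜ)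
  have hX1 := XN_of _ g' (2*g' - 2 + I.card + 1) hg1' (by simp only [List.length_cons, hl1]; omega)
  have hX2 := XN_of _ g'' (2*g'' - 2 + Iᶜ.card + 1) hg1'' (by simp only [List.length_cons, hl2]; omega)
  have hX := XN_of (d :: r) g (2*g-4 + r.length + 3) (by simp; omega) (by simp; omega)
  rw [hX1, hX2, hX]
  rw [Nat.add_sub_cancel, Nat.add_sub_cancel,
    show 2*g-4 + r.length + 3 - 1 = (2*g' - 2 + I.card) + (2*g'' - 2 + Iᶜ.card) + 2 by omega, coef_eq]
  have hcard : (2*g' - 2 + I.card) + (2*g'' - 2 + Iᶜ.card) = r.length + (2*g-4) := by omega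
  have hcast : ((2*g' - 2 + I.card : ℕ) : ℚ) + ((2*g'' - 2 + Iᶜ.card : ℕ) : ℚ) = x - 3 := by
    rw [← Nat.cast_add, hcard, Nat.cast_add, Nat.cast_sub (by omega)]; push_cast; linarith
  rw [hcast, hcard, show 2*g' - 2 + I.card = I.card + (2*g'-2) by omega,
    show x - 3 + 2 = x - 1 by ring, show x - 3 + 1 = x - 2 by ring]
  have hx2 : 0 < x - 2 := by
    have hh : (2:ℚ) ≤ g := by exact_mod_cast (show 2 ≤ g by omega)
    have hr : (0:ℚ) ≤ r.length := by positivity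
    linarith
  have hx1 : 0 < x - 1 := by linarith
  rw [mul_assoc, show 1 / (6 * (x-1) * (x-2) * ((r.length + (2*g-4)).choose (I.card + (2*g'-2)) : ℚ)) = 1 / (6 * (x-1) * (x-2)) * (1 / ((r.length + (2*g-4)).choose (I.card + (2*g'-2)) : ℚ)) by rw [one_div_mul_one_div]]
  rw [mul_assoc, div_eq_mul_one_div q, mul_assoc q, mul_left_comm q]
  apply mul_le_mul_of_nonneg_left _ (by positivity)
  by_cases hone : g' = 1 ∨ g'' = 1
  · refine (h g' g'' hp1 hp2 hgg hg' hg'' hU1 hU2 hone).trans ?_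
    apply mul_le_mul_of_nonneg_left _ (by linarith)
    linarith
  · have hlow := choose_lower r.length I.card g g' (by omega) (by omega)
    have hc : (0:ℚ) < r.length.choose I.card := by
      exact_mod_cast Nat.choose_pos (by omega)
    have hg4 : (4:ℚ) ≤ g := by exact_mod_cast (show 4 ≤ g by omega)
    have hpos : 0 < (2*(g:ℚ)-4)*(2*g-5)/2 := by
      apply div_pos (mul_pos _ _) <;> linarith
    have hprod : C (a :: select r I) * C (b :: select r Iᶜ) ≤ q * q1 := by
      calc _ ≤ (11/9 * q) * (11/9 * q) := mul_le_mul hU1 hU2 hn2 (by linarith)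
        _ ≤ q * q1 := by unfold q1; nlinarith
    calc _ ≤ 1 / ((r.length.choose I.card : ℚ) * ((2*(g:ℚ)-4)*(2*g-5)/2)) * (q * q1) := by
          apply mul_le_mul _ hprod (mul_nonneg hn1 hn2) (by positivity)
          exact one_div_le_one_div_of_le (by positivity) hlow
      _ = q * (Qg g * (1 / (r.length.choose I.card : ℚ))) := by
          unfold Qg; rw [if_pos (by omega)]
          have h4 : 2*(g:ℚ)-4 ≠ 0 := by linarith
          have h5 : 2*(g:ℚ)-5 ≠ 0 := by linarith
          field_simp
      _ ≤ _ := by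
          apply mul_le_mul_of_nonneg_left _ (by linarith)
          linarith

end

end

section

section
variable {C : List ℕ → ℚ}

theorem splitSum_eq (d a b : ℕ) (r : List ℕ) :
    splitSum C d a b r = ∑ I : Finset (Fin r.length), sterm C d a b r I := rfl

theorem select_sum_zero (r : List ℕ) (I : Finset (Fin r.length)) (h : I.card = 0) :
    (select r I).sum = 0 := by
  rw [Finset.card_eq_zero.1 h, select_empty]; rfl

theorem split3_a (hC : IsNormalizedWitten C) {q : ℚ} {N : ℕ} (hq : 318/1000 ≤ q)
    (hq' : q ≤ 319/1000) (hB : Bnd C q N) (d a b : ℕ) (r : List ℕ)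
    (hab : a + b + 2 = d) (h3 : ∀ i ∈ r, 3 ≤ i) (g : ℕ) (x : ℚ)
    (hg : d + r.sum + 3 = 3 * g + (r.length + 1)) (hx : x + 2 = 2 * g + (r.length + 1))
    (hN : 2 * g + (r.length + 1) ≤ N + 2) :
    splitSum C d a b r ≤ q / (6 * (x-1) * (x-2)) *
      ((if a = 1 then 11/54 else 0) + (if b = 1 then 11/54 else 0) + (r.length + 1) * Qg g) := by
  rw [splitSum_eq]
  calc _ ≤ ∑ I : Finset (Fin r.length), q / (6 * (x-1) * (x-2)) *
      (((if I = ∅ then (if a = 1 then 11/54 else 0) else 0) +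
        (if I = Finset.univ then (if b = 1 then 11/54 else 0) else 0)) +
        Qg g * (1 / (r.length.choose I.card : ℚ))) := by
        apply Finset.sum_le_sum
        intro I _
        have hs1 := sum_ge 3 (select r I) (fun i hi => h3 i (select_mem hi))
        have hs2 := sum_ge 3 (select r Iᶜ) (fun i hi => h3 i (select_mem hi))
        rw [select_length] at hs1 hs2
        have hz1 := select_sum_zero r I
        have hz2 := select_sum_zero r Iᶜ
        have hcc : I.card + Iᶜ.card = r.length := by
          rw [Finset.card_add_card_compl, Fintype.card_fin]
        have p1 : (0:ℚ) ≤ (if I = ∅ then (if a = 1 then 11/54 else 0) else 0) := by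
          split_ifs <;> norm_num
        have p2 : (0:ℚ) ≤ (if I = Finset.univ then (if b = 1 then 11/54 else 0) else 0) := by
          split_ifs <;> norm_num
        apply sterm_le hC hq hq' hB d a b r I hab (fun i hi => (by omega : 2 ≤ 3).trans (h3 i hi))
          g x hg hx hN _ (by linarith)
        intro g' g'' h1 h2 hgg e1 e2 u1 u2 hone
        rcases hone with rfl | rfl
        · have hc : I.card = 0 := by omega
          have ha : a = 1 := by omega
          have hI : I = ∅ := Finset.card_eq_zero.1 hc
          subst hI ha
          rw [select_empty, hC.init1]
          rw [if_pos rfl, if_pos rfl]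
          have hqp : 0 ≤ q * (if (∅ : Finset (Fin r.length)) = Finset.univ then
            (if b = 1 then (11/54:ℚ) else 0) else 0) := mul_nonneg (by linarith) p2
          rw [show (∅ : Finset (Fin r.length)).card + (2 * 1 - 2) = 0 by simp, Nat.choose_zero_right,
            mul_add]
          norm_num only [Nat.cast_one]
          linarith
        · have hc : Iᶜ.card = 0 := by omega
          have hb : b = 1 := by omega
          have hI : I = Finset.univ := by
            rw [Finset.card_eq_zero] at hc
            exact compl_eq_bot.1 hc
          subst hI hb
          have hqp : 0 ≤ q * (if (Finset.univ : Finset (Fin r.length)) = ∅ then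
            (if a = 1 then (11/54:ℚ) else 0) else 0) := mul_nonneg (by linarith) p1
          rw [Finset.compl_univ, select_empty, hC.init1]
          rw [if_pos (rfl : (Finset.univ : Finset (Fin r.length)) = Finset.univ), if_pos rfl]
          rw [show (Finset.univ : Finset (Fin r.length)).card + (2 * g' - 2) = r.length + (2*g-4) by
            rw [Finset.card_univ, Fintype.card_fin]; omega, Nat.choose_self,
            mul_add]
          norm_num only [Nat.cast_one]
          linarith
    _ = _ := by
        rw [← Finset.mul_sum, Finset.sum_add_distrib, Finset.sum_add_distrib, ← Finset.mul_sum,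
          sum_inv_choose, Finset.sum_ite_eq', Finset.sum_ite_eq', if_pos (Finset.mem_univ _),
          if_pos (Finset.mem_univ _)]
        ring

theorem split3 (hC : IsNormalizedWitten C) {q : ℚ} {N : ℕ} (hq : 318/1000 ≤ q)
    (hq' : q ≤ 319/1000) (hB : Bnd C q N) (d : ℕ) (r : List ℕ) (hd : 3 ≤ d)
    (h3 : ∀ i ∈ r, d ≤ i) (g : ℕ) (x : ℚ) (hx2 : 2 < x)
    (hg : d + r.sum + 3 = 3 * g + (r.length + 1)) (hx : x + 2 = 2 * g + (r.length + 1))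
    (hN : 2 * g + (r.length + 1) ≤ N + 2) :
    ∑ a ∈ Finset.range (d-1), splitSum C d a (d-2-a) r ≤ q / (6 * (x-1) * (x-2)) *
      (11/27 + (3 * (g:ℚ) - 3) * Qg g) := by
  have hs := sum_ge d r h3
  obtain ⟨k, rfl⟩ : ∃ k, d = k + 3 := ⟨d - 3, by omega⟩
  have hQ := Qg_nonneg g
  calc _ ≤ ∑ a ∈ Finset.range (k+2), q / (6 * (x-1) * (x-2)) *
      ((if a = 1 then 11/54 else 0) + (if a = k then 11/54 else 0) + (r.length + 1) * Qg g) := by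
        apply Finset.sum_le_sum
        intro a ha
        rw [Finset.mem_range] at ha
        have := split3_a hC hq hq' hB (k+3) a (k+3-2-a) r (by omega)
          (fun i hi => hd.trans (h3 i hi)) g x hg hx hN
        have e : (k + 3 - 2 - a = 1) = (a = k) := by
          apply propext; omega
        simp only [e] at this
        exact this
    _ = q / (6 * (x-1) * (x-2)) * (11/27 + ((k:ℚ)+2) * (r.length + 1) * Qg g) := by
        rw [← Finset.mul_sum, Finset.sum_add_distrib, Finset.sum_add_distrib,
          Finset.sum_ite_eq', Finset.sum_ite_eq', if_pos (by simp), if_pos (by simp)]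
        rw [Finset.sum_const, Finset.card_range, nsmul_eq_mul]
        push_cast
        ring
    _ ≤ _ := by
        apply mul_le_mul_of_nonneg_left
        · have hh : (k+2) * (r.length + 1) + 3 ≤ 3 * g := by nlinarith
          have hh' : ((k:ℚ)+2) * (r.length + 1) + 3 ≤ 3 * g := by exact_mod_cast hh
          nlinarith
        · apply div_nonneg (by linarith)
          apply mul_nonneg <;> linarith

theorem split2 (hC : IsNormalizedWitten C) {q : ℚ} {N : ℕ} (hq : 318/1000 ≤ q)
    (hq' : q ≤ 319/1000) (hB : Bnd C q N) (r : List ℕ)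
    (h2 : ∀ i ∈ r, 2 ≤ i) (g : ℕ) (x : ℚ) (hx3 : 3 < x)
    (hg : 2 + r.sum + 3 = 3 * g + (r.length + 1)) (hx : x + 2 = 2 * g + (r.length + 1))
    (hN : 2 * g + (r.length + 1) ≤ N + 2) :
    splitSum C 2 0 0 r ≤ q / (6 * (x-1) * (x-2)) *
      (2 * r.length * q1 / (x-3) + (r.length + 1) * Qg g) := by
  rw [splitSum_eq]
  have hq10 : 0 ≤ q1 / (x-3) := div_nonneg (by unfold q1; norm_num) (by linarith)
  calc _ ≤ ∑ I : Finset (Fin r.length), q / (6 * (x-1) * (x-2)) *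
      (((if I.card = 1 then (1:ℚ) else 0) * (q1/(x-3)) +
        (if Iᶜ.card = 1 then (1:ℚ) else 0) * (q1/(x-3))) +
        Qg g * (1 / (r.length.choose I.card : ℚ))) := by
        apply Finset.sum_le_sum
        intro I _
        have hs1 := sum_ge 2 (select r I) (fun i hi => h2 i (select_mem hi))
        have hs2 := sum_ge 2 (select r Iᶜ) (fun i hi => h2 i (select_mem hi))
        rw [select_length] at hs1 hs2
        have hz1 := select_sum_zero r I
        have hz2 := select_sum_zero r Iᶜ
        have hcc : I.card + Iᶜ.card = r.length := by
          rw [Finset.card_add_card_compl, Fintype.card_fin]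
        have p1 : (0:ℚ) ≤ (if I.card = 1 then (1:ℚ) else 0) * (q1/(x-3)) := by
          split_ifs <;> simp [hq10]
        have p2 : (0:ℚ) ≤ (if Iᶜ.card = 1 then (1:ℚ) else 0) * (q1/(x-3)) := by
          split_ifs <;> simp [hq10]
        apply sterm_le hC hq hq' hB 2 0 0 r I rfl h2
          g x hg hx hN _ (by linarith)
        intro g' g'' h1 h2 hgg e1 e2 u1 u2 hone
        have hprod : C (0 :: select r I) * C (0 :: select r Iᶜ) ≤ q * q1 := by
          calc _ ≤ (11/9 * q) * (11/9 * q) := mul_le_mul u1 u2 (hC.nn _ _) (by linarith)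
            _ ≤ q * q1 := by unfold q1; nlinarith
        have hM : (((r.length + (2*g-4) : ℕ)) : ℚ) = x - 3 := by
          rw [Nat.cast_add, Nat.cast_sub (by omega)]; push_cast; linarith
        have hfin : 1 / (x-3) * (C (0 :: select r I) * C (0 :: select r Iᶜ)) ≤ q * (q1/(x-3)) := by
          calc _ ≤ 1 / (x-3) * (q * q1) := by
                apply mul_le_mul_of_nonneg_left hprod
                apply div_nonneg (by norm_num); linarith
            _ = _ := by ring
        rcases hone with rfl | rfl
        · have hc : I.card = 1 := by omega
          rw [if_pos hc] at *
          rw [hc, show 1 + (2 * 1 - 2) = 1 by norm_num, Nat.choose_one_right, hM]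
          refine hfin.trans ?_
          apply mul_le_mul_of_nonneg_left _ (by linarith)
          linarith
        · have hc : Iᶜ.card = 1 := by omega
          rw [if_pos hc] at *
          rw [show I.card + (2 * g' - 2) = r.length + (2*g-4) - 1 by omega,
            Nat.choose_symm (by omega : 1 ≤ r.length + (2*g-4)), Nat.choose_one_right, hM]
          refine hfin.trans ?_
          apply mul_le_mul_of_nonneg_left _ (by linarith)
          linarith
    _ = _ := by
        rw [← Finset.mul_sum, Finset.sum_add_distrib, Finset.sum_add_distrib, ← Finset.mul_sum,
          sum_inv_choose, ← Finset.sum_mul, ← Finset.sum_mul, sum_card_one, sum_card_compl_one]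
        ring

theorem split2_one (hC : IsNormalizedWitten C) (e : ℕ) : splitSum C 2 0 0 [e] = 0 := by
  rw [splitSum_eq]
  apply Finset.sum_eq_zero
  intro I _
  have hcc := select_length_compl [e] I
  have h1 : [e].length = 1 := rfl
  have : select [e] I = [] ∨ select [e] Iᶜ = [] := by
    rw [← List.length_eq_zero_iff, ← List.length_eq_zero_iff]; omega
  unfold sterm
  split_ifs
  · rcases this with h | h <;> rw [h, C_nil_zero hC] <;> simp
  · rfl
end

end

section

theorem Gf_one (x : ℚ) : Gf x 1 = G1 x := by simp [Gf]

theorem Gf_big (x : ℚ) {n : ℕ} (h : 2 ≤ n) : Gf x n = Gn x n := by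
  unfold Gf; rw [if_neg (by omega)]

theorem Gf_nonneg (x : ℚ) (n : ℕ) (hx : 1 ≤ x) (hu : (n:ℚ) ≤ x + 2) : 0 ≤ Gf x n := by
  unfold Gf
  split_ifs with h
  · unfold G1
    have : 47/50 / (x+1) ≤ 1 := by rw [div_le_one (by linarith)]; linarith
    linarith
  · unfold Gn
    have h1 : 0 ≤ 3/5 * (n:ℚ) / (x - n + 3) := div_nonneg (by positivity) (by linarith)
    have : (9/10 - 3/5 * (n:ℚ) / (x - n + 3)) / x ≤ 1 := by
      rw [div_le_one (by linarith)]; linarith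
    linarith

theorem Gf_F1 (m g : ℕ) (x : ℚ) (hm : 1 ≤ m) (hg : 1 ≤ g) (hx : x = 2 * g - 2 + (m + 1)) :
    Gf (x - 1) m ≤ Gf x (m+1) := by
  have hgq : (1:ℚ) ≤ g := by exact_mod_cast hg
  rw [Gf_big x (by omega)]
  rcases Nat.eq_or_lt_of_le hm with rfl | h
  · rw [Gf_one]
    have := F1two g x (by rw [hx]; norm_num) hgq
    norm_num
    exact this
  · rw [Gf_big _ (by omega)]
    have h2 : (2:ℚ) ≤ m := by exact_mod_cast h
    have := F1n (m+1) g x hx (by linarith) hgq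
    push_cast
    simpa using this

theorem Qg_of {g : ℕ} (h : 4 ≤ g) : Qg g = 2 * q1 / ((2*(g:ℚ)-4)*(2*g-5)) := if_pos h

theorem Qg_three : Qg 3 = 0 := by unfold Qg; simp

theorem J2 (m g : ℕ) (x : ℚ) (hx : x = 2 * g - 2 + (m + 1)) (hm : 2 ≤ m) (hg3 : 3 ≤ g)
    (hg : m + 1 + 3 ≤ 3 * g) :
    (1 - 2/(3*(x-1))) * Gf (x-1) m
      + 2/(3*(x-1)) * (1 + 1/(3*(x-2))) * (1 + 2/(3*(x-4))) * Gf (x-3) m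
      + 1/(6*(x-1)*(x-2)) * (2 * m * q1 / (x-3) + (m+1) * Qg g) ≤ Gf x (m+1) := by
  rw [Gf_big _ hm, Gf_big _ hm, Gf_big _ (by omega : 2 ≤ m + 1)]
  have em : ((m:ℚ)) = (m + 1 : ℚ) - 1 := by ring
  have hgq : (m:ℚ) + 1 + 3 ≤ 3 * g := by exact_mod_cast hg
  push_cast
  rcases Nat.eq_or_lt_of_le hg3 with rfl | h4
  · have := J2n_three (m+1) x (by rw [hx]; norm_num) (by
      have : m ≤ 5 := by omega
      interval_cases m <;> norm_num)
    rw [Qg_three, mul_zero, add_zero]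
    simpa using this
  · rw [Qg_of h4]
    have h4q : (4:ℚ) ≤ g := by exact_mod_cast h4
    by_cases h9 : 9 ≤ m
    · have h9q : (9:ℚ) ≤ m := by exact_mod_cast h9
      have := J2n_big (m+1) g x hx (by linarith) (by linarith)
      rwa [← em] at this
    · have := J2n_small (m+1) g x hx (by interval_cases m <;> norm_num) h4q
      rwa [← em] at this

theorem J2' (g : ℕ) (x : ℚ) (hx : x = 2 * g) (hg3 : 3 ≤ g) :
    (1 - 2/(3*(x-1))) * Gf (x-1) 1
      + 2/(3*(x-1)) * (1 + 1/(3*(x-2))) * (1 + 2/(3*(x-4))) * Gf (x-3) 1 ≤ Gf x 2 := by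
  rw [Gf_one, Gf_one, Gf_big _ le_rfl]
  apply J2two g x hx
  rcases Nat.eq_or_lt_of_le hg3 with rfl | h4
  · left; norm_num
  · right; exact_mod_cast h4

theorem J3 (m g : ℕ) (x : ℚ) (hx : x = 2 * g - 2 + (m + 1)) (hm : 1 ≤ m)
    (hg : 2 * (m + 1) + 3 ≤ 3 * g) :
    (1 - 2 * (2/(3*(x-1)))) * Gf (x-1) m
      + 2 * (2/(3*(x-1))) * (1 + 2/(3*(x-3))) * Gf (x-3) m
      + 1/(6*(x-1)*(x-2)) * (11/27 + (3*(g:ℚ)-3) * Qg g) ≤ Gf x (m+1) := by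
  rw [Gf_big _ (by omega : 2 ≤ m + 1)]
  have em : ((m:ℚ)) = (m + 1 : ℚ) - 1 := by ring
  have hgq : 2 * ((m:ℚ) + 1) + 3 ≤ 3 * g := by exact_mod_cast hg
  have hg3 : 3 ≤ g := by omega
  rcases Nat.eq_or_lt_of_le hm with rfl | hm2
  · rw [Gf_one, Gf_one]
    norm_num only [Nat.cast_one] at hx ⊢
    push_cast
    rcases Nat.eq_or_lt_of_le hg3 with rfl | h4
    · rw [Qg_three, mul_zero, add_zero]
      exact J3two_three x (by rw [hx]; norm_num)
    · rw [Qg_of h4]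
      exact J3two g x (by rw [hx]; ring) (by exact_mod_cast h4)
  · rw [Gf_big _ hm2, Gf_big _ hm2]
    push_cast
    rcases Nat.eq_or_lt_of_le hg3 with rfl | h4
    · have hm2 : m = 2 := by omega
      subst hm2
      rw [Qg_three, mul_zero, add_zero]
      have := J3n_three 3 x (by rw [hx]; norm_num) rfl
      norm_num at this ⊢
      exact this
    · rw [Qg_of h4]
      have h4q : (4:ℚ) ≤ g := by exact_mod_cast h4
      by_cases h9 : 4 ≤ m
      · have h9q : (4:ℚ) ≤ m := by exact_mod_cast h9
        have := J3n_big (m+1) g x hx (by linarith) (by linarith)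
        rwa [← em] at this
      · have := J3n_small (m+1) g x hx (by interval_cases m <;> norm_num) h4q
        rwa [← em] at this

theorem J4 (m g : ℕ) (x : ℚ) (hx : x = 2 * g - 2 + (m + 1)) (hm : 1 ≤ m)
    (hg : 3 * (m + 1) + 3 ≤ 3 * g) :
    (1 - 3 * (2/(3*(x-1)))) * Gf (x-1) m + 2/(3*(x-1)) * Gf (x-3) m
      + 2 * (2/(3*(x-1))) * (1 + 2/(3*(x-2))) * Gf (x-2) (m+1)
      + 1/(6*(x-1)*(x-2)) * (11/27 + (3*(g:ℚ)-3) * Qg g) ≤ Gf x (m+1) := by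
  rw [Gf_big x (by omega : 2 ≤ m + 1), Gf_big _ (by omega : 2 ≤ m + 1)]
  have em : ((m:ℚ)) = (m + 1 : ℚ) - 1 := by ring
  have hgq : 3 * ((m:ℚ) + 1) + 3 ≤ 3 * g := by exact_mod_cast hg
  have hg3 : 3 ≤ g := by omega
  rcases Nat.eq_or_lt_of_le hm with rfl | hm2
  · rw [Gf_one, Gf_one]
    norm_num only [Nat.cast_one] at hx ⊢
    push_cast
    rcases Nat.eq_or_lt_of_le hg3 with rfl | h4
    · rw [Qg_three, mul_zero, add_zero]
      exact J4two_three x (by rw [hx]; norm_num)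
    · rw [Qg_of h4]
      exact J4two g x (by rw [hx]; ring) (by exact_mod_cast h4)
  · rw [Gf_big _ hm2, Gf_big _ hm2]
    push_cast
    rw [Qg_of (by omega)]
    have hmq : (2:ℚ) ≤ m := by exact_mod_cast hm2
    have := J4n (m+1) g x hx (by linarith) (by linarith)
    rwa [← em] at this

theorem J5 (m g e : ℕ) (x : ℚ) (hx : x = 2 * g - 2 + (m + 1)) (hm : 1 ≤ m) (he : 4 ≤ e)
    (hg : e * (m + 1) + 3 ≤ 3 * g) :
    (1 - e * (2/(3*(x-1)))) * Gf (x-1) m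
      + (e - 4) * (2/(3*(x-1))) * Gf (x-1) (m+2)
      + (2 * (2/(3*(x-1))) * Gf (x-2) (m+1)
      + 2 * (2/(3*(x-1))) * (1 + 2/(3*(x-2))) * Gf (x-2) (m+1)
      + 1/(6*(x-1)*(x-2)) * (11/27 + (3*(g:ℚ)-3) * Qg g)) ≤ Gf x (m+1) := by
  rw [Gf_big x (by omega : 2 ≤ m + 1), Gf_big (x-2) (by omega : 2 ≤ m + 1),
    Gf_big _ (by omega : 2 ≤ m + 2)]
  have em : ((m:ℚ)) = (m + 1 : ℚ) - 1 := by ring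
  have em2 : ((m:ℚ)) + 2 = (m + 1 : ℚ) + 1 := by ring
  have heq : (4:ℚ) ≤ e := by exact_mod_cast he
  have hgq : (e:ℚ) * ((m:ℚ) + 1) + 3 ≤ 3 * g := by exact_mod_cast hg
  rcases Nat.eq_or_lt_of_le hm with rfl | hm2
  · have hg4 : 4 ≤ g := by omega
    rw [Gf_one, Qg_of hg4]
    norm_num only [Nat.cast_one] at hx ⊢
    push_cast at hgq ⊢
    apply J5two g x e (by rw [hx]; ring) _ heq (by linarith)
    rcases Nat.eq_or_lt_of_le hg4 with rfl | h5
    · left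
      have : e = 4 := by omega
      subst this
      norm_num
    · right; exact_mod_cast h5
  · rw [Gf_big _ hm2, Qg_of (by nlinarith)]
    push_cast
    have hmq : (2:ℚ) ≤ m := by exact_mod_cast hm2
    have := J5n (m+1) g x e hx (by linarith) heq (by linarith)
    rwa [← em, ← em2] at this

end

section

section
variable {C : List ℕ → ℚ}

theorem dvv_le (hC : IsNormalizedWitten C) {q : ℚ} {N : ℕ} (hB : Bnd C q N)
    (d : ℕ) (r : List ℕ) (hd : 2 ≤ d) (hne : r ≠ []) (hr : ∀ i ∈ r, 1 ≤ i) (g : ℕ) (x : ℚ)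
    (hg : d + r.sum + 3 = 3 * g + (r.length + 1)) (hx : x + 2 = 2 * g + (r.length + 1))
    (hx1 : 2 ≤ x) (hN : 2 * g + (r.length + 1) = N + 2) :
    C (d :: r) ≤ (1 - ((d:ℚ) - 1) * (2/(3*(x-1)))) * (q * Gf (x-1) r.length)
      + (2/(3*(x-1)) * ∑ a ∈ Finset.range (d-1), C (a :: (d-2-a) :: r)
      + ∑ a ∈ Finset.range (d-1), splitSum C d a (d-2-a) r) := by
  have hgq : (d:ℚ) + r.sum + 3 = 3 * g + (r.length + 1) := by exact_mod_cast hg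
  have hT' : (T3 (d :: r) : ℚ) = 3 * x := by
    rw [T3_cast, List.sum_cons, List.length_cons, Nat.cast_add, Nat.cast_add]; push_cast
    rw [← Nat.cast_list_sum]
    linarith
  have hT6 : 6 ≤ T3 (d :: r) := by
    have : (6:ℚ) ≤ T3 (d :: r) := by rw [hT']; linarith
    exact_mod_cast this
  rw [hC.dvv' d r ⟨g, by simpa using hg⟩ hT6]
  have hf := first_le (C := C) d r g x (q * Gf (x-1) r.length) (by omega) hg hx (by linarith) (by
    intro j
    have hsum := sum_set_add r j j.2 (d + r.get j - 1)
    have := hB (r.set j (d + r.get j - 1)) g (x-1) (set_ne hne _ _) (by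
      intro i hi
      rcases List.mem_or_eq_of_mem_set hi with hi | hi
      · exact hr i hi
      · omega) (by rw [List.length_set]; simp only [List.get_eq_getElem] at *; omega)
      (by rw [List.length_set]; linarith) (by rw [List.length_set]; omega)
    rwa [List.length_set] at this)
  refine add_le_add hf (le_of_eq ?_)
  rw [Finset.sum_add_distrib, ← Finset.mul_sum, hT', show 3 * x - 3 = 3 * (x - 1) by ring]

theorem len_pos {r : List ℕ} (hne : r ≠ []) : 1 ≤ r.length := List.length_pos_iff.2 hne

theorem C00 (hC : IsNormalizedWitten C) {q : ℚ} {N : ℕ} (hq : 318/1000 ≤ q) (hB : Bnd C q N)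
    (r : List ℕ) (hne : r ≠ []) (h2 : ∀ i ∈ r, 2 ≤ i) (g : ℕ) (x : ℚ)
    (hg : 2 + r.sum + 3 = 3 * g + (r.length + 1)) (hx : x + 2 = 2 * g + (r.length + 1))
    (hx1 : 5 ≤ x) (hN : 2 * g + (r.length + 1) = N + 2) :
    C (0 :: 0 :: r) ≤ (1 + 1/(3*(x-2))) * ((1 + 2/(3*(x-4))) * (q * Gf (x-3) r.length)) := by
  have hs := sum_ge 2 r h2
  have hl := len_pos hne
  have hlq : (1:ℚ) ≤ r.length := by exact_mod_cast hl
  obtain ⟨g, rfl⟩ : ∃ k, g = k + 1 := ⟨g - 1, by omega⟩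
  push_cast at hx
  have hg1 : 1 ≤ g := by omega
  have hg1q : (1:ℚ) ≤ g := by exact_mod_cast hg1
  refine string00_le hC r g (x-2) _ (by omega) (by linarith) (by linarith)
    (fun i hi => by have := h2 i hi; omega) ?_
  intro j
  have hG := Gf_nonneg (x-3) r.length (by linarith) (by linarith)
  obtain ⟨ha, hb⟩ := set_pred h2 j
  by_cases hj : r.get j = 2
  · have hp : (r.set j (r.get j - 1)).Perm (1 :: r.eraseIdx j) := by
      rw [hj]; exact List.set_perm_cons_eraseIdx j.2 1
    have hp0 : (0 :: r.set j (r.get j - 1)).Perm (1 :: 0 :: r.eraseIdx j) :=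
      (hp.cons 0).trans (List.Perm.swap _ _ _)
    rw [hC.symm hp0, hC.dilaton _ (by simp)]
    have hlen : (r.eraseIdx j).length + 1 = r.length := by
      have := hp.length_eq; simp only [List.length_set, List.length_cons] at this; omega
    have hsum : (r.eraseIdx j).sum + 2 = r.sum := by
      have := hp.sum_eq; simp only [List.sum_cons] at this; omega
    have hne' : r.eraseIdx j ≠ [] := by
      intro h
      rw [h] at hlen hsum
      simp at hlen hsum
      omega
    have hl' := len_pos hne'
    have hlenq : ((r.eraseIdx j).length : ℚ) + 1 = r.length := by exact_mod_cast hlen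
    have := Z1 hC hB (r.eraseIdx j) g (x-4) hne' (fun i hi => h2 i (List.mem_of_mem_eraseIdx hi))
      (by omega) (by linarith) (by omega)
    refine this.trans ?_
    apply mul_le_mul_of_nonneg_left
    · apply mul_le_mul_of_nonneg_left _ (by linarith)
      have := Gf_F1 (r.eraseIdx j).length g (x-3) hl' hg1 (by linarith)
      rw [hlen] at this
      rwa [show x - 3 - 1 = x - 4 by ring] at this
    · have : 0 ≤ 2/(3*(x-4)) := div_nonneg (by norm_num) (by linarith)
      linarith
  · have h2' : ∀ i ∈ r.set j (r.get j - 1), 2 ≤ i := by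
      intro i hi
      rcases List.mem_or_eq_of_mem_set hi with hi | hi
      · exact h2 i hi
      · have := h2 _ (List.get_mem r j); omega
    have := Z1 hC hB _ g (x-3) (set_ne hne _ _) h2' (by rw [List.length_set]; omega)
      (by rw [List.length_set]; linarith) (by rw [List.length_set]; omega)
    rw [List.length_set] at this
    refine this.trans ?_
    apply mul_le_mul_of_nonneg_right _ (mul_nonneg (by linarith) hG)
    have : 2/(3*(x-3)) ≤ 2/(3*(x-4)) := by
      apply div_le_div_of_nonneg_left <;> linarith
    linarith

/-- hypothesis-free form of the conclusion of a step. -/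
theorem step2 (hC : IsNormalizedWitten C) {q : ℚ} {N : ℕ} (hq : 318/1000 ≤ q)
    (hq' : q ≤ 319/1000) (hB : Bnd C q N)
    (r : List ℕ) (hne : r ≠ []) (h2 : ∀ i ∈ r, 2 ≤ i) (g : ℕ) (x : ℚ)
    (hg : 2 + r.sum + 3 = 3 * g + (r.length + 1)) (hx : x + 2 = 2 * g + (r.length + 1))
    (hN : 2 * g + (r.length + 1) = N + 2) :
    C (2 :: r) ≤ q * Gf x (r.length + 1) := by
  have hs := sum_ge 2 r h2
  have hl := len_pos hne
  have hlq : (1:ℚ) ≤ r.length := by exact_mod_cast hl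
  have hg2 : 2 ≤ g := by omega
  have hg2q : (2:ℚ) ≤ g := by exact_mod_cast hg2
  have hD := dvv_le hC hB 2 r le_rfl hne (fun i hi => by have := h2 i hi; omega) g x hg hx
    (by linarith) hN
  simp only [Finset.sum_range_succ, Finset.sum_range_zero, show 2 - 1 = 0 + 1 from rfl,
    show 2 - 2 - 0 = 0 from rfl, zero_add] at hD
  have hw : 0 ≤ 2/(3*(x-1)) := div_nonneg (by norm_num) (by linarith)
  rcases Nat.eq_or_lt_of_le hg2 with h2g | hg3
  · -- g = 2
    subst h2g
    have h00 : C (0 :: 0 :: r) ≤ (1 + 1/(3*(x-2))) * (5/18) := by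
      refine string00_le hC r 1 (x-2) _ (by omega) (by push_cast at hx ⊢; linarith)
        (by push_cast at hx; linarith) (fun i hi => by have := h2 i hi; omega) ?_
      have h02 := C_02 hC
      rcases (by omega : r.length = 1 ∨ r.length = 2) with h1 | h1
      · obtain ⟨e, rfl⟩ := List.length_eq_one_iff.1 h1
        have : e = 3 := by simp at hg; omega
        subst this
        intro j
        fin_cases j
        exact h02
      · obtain ⟨e, e', rfl⟩ := List.length_eq_two.1 h1
        have he := h2 e (by simp)
        have he' := h2 e' (by simp)
        have : e = 2 ∧ e' = 2 := by simp at hg; omega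
        obtain ⟨rfl, rfl⟩ := this
        intro j
        fin_cases j
        · show C [0,1,2] ≤ 5/18
          rw [hC.symm (List.Perm.swap 1 0 [2]), hC.dilaton _ (by simp)]
          exact h02
        · show C [0,2,1] ≤ 5/18
          rw [hC.symm (show [0,2,1].Perm [1,0,2] by decide), hC.dilaton _ (by simp)]
          exact h02
    have h00' := mul_le_mul_of_nonneg_left h00 hw
    rcases (by omega : r.length = 1 ∨ r.length = 2) with h1 | h1
    · obtain ⟨e, rfl⟩ := List.length_eq_one_iff.1 h1
      rw [split2_one hC] at hD
      have hx4 : x = 4 := by norm_num at hx; linarith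
      subst hx4
      simp only [List.length_singleton, Gf_one, Gf_big _ (le_refl 2)] at hD ⊢
      unfold G1 at hD
      unfold Gn
      norm_num at hD h00' ⊢
      linarith
    · have hx5 : x = 5 := by rw [h1] at hx; norm_num at hx; linarith
      have hS := split2 hC hq hq' hB r h2 2 x (by rw [hx5]; norm_num) hg hx hN.le
      subst hx5
      rw [h1] at hD hS ⊢
      rw [Gf_big _ le_rfl] at hD
      rw [Gf_big _ (by norm_num)]
      unfold Gn at hD ⊢
      unfold Qg q1 at hS
      norm_num at hD h00' hS ⊢
      linarith
  · have hg3q : (3:ℚ) ≤ g := by exact_mod_cast hg3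
    have h00 := mul_le_mul_of_nonneg_left (C00 hC hq hB r hne h2 g x hg hx (by linarith) hN) hw
    rcases Nat.eq_or_lt_of_le hl with h1 | h1
    · obtain ⟨e, rfl⟩ := List.length_eq_one_iff.1 h1.symm
      rw [split2_one hC] at hD
      have hJ := mul_le_mul_of_nonneg_left
        (J2' g x (by norm_num at hx; linarith) hg3) (by linarith : 0 ≤ q)
      simp only [List.length_singleton] at *
      refine le_trans (hD.trans (add_le_add le_rfl (add_le_add h00 le_rfl))) (le_trans (le_of_eq ?_) hJ)
      push_cast; ring
    · have hS := split2 hC hq hq' hB r h2 g x (by linarith) hg hx hN.le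
      have hJ := mul_le_mul_of_nonneg_left
        (J2 r.length g x (by linarith) h1 hg3 (by omega)) (by linarith : 0 ≤ q)
      refine le_trans (hD.trans (add_le_add le_rfl (add_le_add h00 hS))) (le_trans (le_of_eq ?_) hJ)
      push_cast; ring

theorem step3 (hC : IsNormalizedWitten C) {q : ℚ} {N : ℕ} (hq : 318/1000 ≤ q)
    (hq' : q ≤ 319/1000) (hB : Bnd C q N)
    (r : List ℕ) (hne : r ≠ []) (h3 : ∀ i ∈ r, 3 ≤ i) (g : ℕ) (x : ℚ)
    (hg : 3 + r.sum + 3 = 3 * g + (r.length + 1)) (hx : x + 2 = 2 * g + (r.length + 1))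
    (hN : 2 * g + (r.length + 1) = N + 2) :
    C (3 :: r) ≤ q * Gf x (r.length + 1) := by
  have hs := sum_ge 3 r h3
  have hl := len_pos hne
  have hlq : (1:ℚ) ≤ r.length := by exact_mod_cast hl
  have hg2 : 3 ≤ g := by omega
  have hg2q : (3:ℚ) ≤ g := by exact_mod_cast hg2
  have hD := dvv_le hC hB 3 r (by norm_num) hne (fun i hi => by have := h3 i hi; omega) g x hg hx
    (by linarith) hN
  have hS := split3 hC hq hq' hB 3 r le_rfl h3 g x (by linarith) hg hx hN.le
  have hw : 0 ≤ 2/(3*(x-1)) := div_nonneg (by norm_num) (by linarith)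
  have hsum : ∑ a ∈ Finset.range (3-1), C (a :: (3-2-a) :: r) ≤
      2 * ((1 + 2/(3*(x-3))) * (q * Gf (x-3) r.length)) := by
    obtain ⟨g, rfl⟩ : ∃ k, g = k + 1 := ⟨g - 1, by omega⟩
    push_cast at hx
    have hz := Z1 hC hB r g (x-3) hne (fun i hi => by have := h3 i hi; omega) (by omega)
      (by linarith) (by omega)
    simp only [show 3 - 1 = 0 + 1 + 1 from rfl, Finset.sum_range_succ, Finset.sum_range_zero]
    norm_num only [zero_add]
    rw [hC.symm (List.Perm.swap 1 0 r), hC.dilaton _ (by simp)]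
    linarith
  have hJ := mul_le_mul_of_nonneg_left
    (J3 r.length g x (by linarith) hl (by omega)) (by linarith : 0 ≤ q)
  refine le_trans (hD.trans (add_le_add le_rfl (add_le_add
    (mul_le_mul_of_nonneg_left hsum hw) hS))) (le_trans (le_of_eq ?_) hJ)
  push_cast; ring

theorem step4 (hC : IsNormalizedWitten C) {q : ℚ} {N : ℕ} (hq : 318/1000 ≤ q)
    (hq' : q ≤ 319/1000) (hB : Bnd C q N)
    (r : List ℕ) (hne : r ≠ []) (h3 : ∀ i ∈ r, 4 ≤ i) (g : ℕ) (x : ℚ)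
    (hg : 4 + r.sum + 3 = 3 * g + (r.length + 1)) (hx : x + 2 = 2 * g + (r.length + 1))
    (hN : 2 * g + (r.length + 1) = N + 2) :
    C (4 :: r) ≤ q * Gf x (r.length + 1) := by
  have hs := sum_ge 4 r h3
  have hl := len_pos hne
  have hlq : (1:ℚ) ≤ r.length := by exact_mod_cast hl
  have hg2 : 3 ≤ g := by omega
  have hg2q : (3:ℚ) ≤ g := by exact_mod_cast hg2
  have hD := dvv_le hC hB 4 r (by norm_num) hne (fun i hi => by have := h3 i hi; omega) g x hg hx
    (by linarith) hN
  have hS := split3 hC hq hq' hB 4 r (by norm_num) h3 g x (by linarith) hg hx hN.le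
  have hw : 0 ≤ 2/(3*(x-1)) := div_nonneg (by norm_num) (by linarith)
  have hsum : ∑ a ∈ Finset.range (4-1), C (a :: (4-2-a) :: r) ≤
      q * Gf (x-3) r.length + 2 * ((1 + 2/(3*(x-2))) * (q * Gf (x-2) (r.length+1))) := by
    obtain ⟨g, rfl⟩ : ∃ k, g = k + 1 := ⟨g - 1, by omega⟩
    push_cast at hx
    have hz := Z1 hC hB (2 :: r) g (x-2) (by simp) (by
      intro i hi
      rcases List.mem_cons.1 hi with rfl | hi
      · exact le_rfl
      · have := h3 i hi; omega) (by simp; omega)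
      (by simp only [List.length_cons]; push_cast; linarith) (by simp; omega)
    have hb := hB r g (x-3) hne (fun i hi => by have := h3 i hi; omega) (by omega) (by linarith)
      (by omega)
    simp only [show 4 - 1 = 0 + 1 + 1 + 1 from rfl, Finset.sum_range_succ, Finset.sum_range_zero]
    norm_num only [zero_add]
    rw [hC.symm (List.Perm.swap 0 2 r), hC.dilaton _ (by simp), hC.dilaton _ hne]
    rw [List.length_cons] at hz
    linarith
  have hJ := mul_le_mul_of_nonneg_left
    (J4 r.length g x (by linarith) hl (by omega)) (by linarith : 0 ≤ q)
  refine le_trans (hD.trans (add_le_add le_rfl (add_le_add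
    (mul_le_mul_of_nonneg_left hsum hw) hS))) (le_trans (le_of_eq ?_) hJ)
  push_cast; ring

theorem step5 (hC : IsNormalizedWitten C) {q : ℚ} {N : ℕ} (hq : 318/1000 ≤ q)
    (hq' : q ≤ 319/1000) (hB : Bnd C q N) (k : ℕ)
    (r : List ℕ) (hne : r ≠ []) (h3 : ∀ i ∈ r, k + 5 ≤ i) (g : ℕ) (x : ℚ)
    (hg : k + 5 + r.sum + 3 = 3 * g + (r.length + 1)) (hx : x + 2 = 2 * g + (r.length + 1))
    (hN : 2 * g + (r.length + 1) = N + 2) :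
    C ((k + 5) :: r) ≤ q * Gf x (r.length + 1) := by
  have hs := sum_ge (k+5) r h3
  have hs5 := sum_ge 5 r (fun i hi => by have := h3 i hi; omega)
  have hl := len_pos hne
  have hlq : (1:ℚ) ≤ r.length := by exact_mod_cast hl
  have hg2 : 3 ≤ g := by omega
  have hg2q : (3:ℚ) ≤ g := by exact_mod_cast hg2
  have h1r : ∀ i ∈ r, 2 ≤ i := fun i hi => by have := h3 i hi; omega
  have hD := dvv_le hC hB (k+5) r (by omega) hne (fun i hi => by have := h3 i hi; omega) g x hg hx
    (by linarith) hN
  have hS := split3 hC hq hq' hB (k+5) r (by omega) h3 g x (by linarith) hg hx hN.le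
  have hw : 0 ≤ 2/(3*(x-1)) := div_nonneg (by norm_num) (by linarith)
  have hsum : ∑ a ∈ Finset.range (k+5-1), C (a :: (k+5-2-a) :: r) ≤
      k * (q * Gf (x-1) (r.length+2)) + (2 * (q * Gf (x-2) (r.length+1)) +
        2 * ((1 + 2/(3*(x-2))) * (q * Gf (x-2) (r.length+1)))) := by
    obtain ⟨g, rfl⟩ : ∃ k, g = k + 1 := ⟨g - 1, by omega⟩
    push_cast at hx
    have hz := Z1 hC hB ((k+3) :: r) g (x-2) (by simp) (by
      intro i hi
      rcases List.mem_cons.1 hi with rfl | hi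
      · omega
      · exact h1r i hi) (by simp; omega)
      (by simp only [List.length_cons]; push_cast; linarith) (by simp; omega)
    have hb := hB ((k+2) :: r) g (x-2) (by simp) (by
      intro i hi
      rcases List.mem_cons.1 hi with rfl | hi
      · omega
      · have := h1r i hi; omega) (by simp; omega)
      (by simp only [List.length_cons]; push_cast; linarith) (by simp; omega)
    rw [List.length_cons] at hz hb
    rw [show k + 5 - 1 = (k + 1 + 1) + 1 + 1 by omega, Finset.sum_range_succ, Finset.sum_range_succ,
      Finset.sum_range_succ', Finset.sum_range_succ']
    have hmid : ∑ a ∈ Finset.range k, C ((a+1+1) :: (k+5-2-(a+1+1)) :: r) ≤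
        k * (q * Gf (x-1) (r.length+2)) := by
      calc _ ≤ ∑ a ∈ Finset.range k, (q * Gf (x-1) (r.length+2)) := by
            apply Finset.sum_le_sum
            intro a ha
            rw [Finset.mem_range] at ha
            have := hB ((a+1+1) :: (k+5-2-(a+1+1)) :: r) g (x-1) (by simp) (by
              intro i hi
              rcases List.mem_cons.1 hi with rfl | hi
              · omega
              rcases List.mem_cons.1 hi with rfl | hi
              · omega
              · have := h1r i hi; omega)
              (by simp only [List.sum_cons, List.length_cons]; omega)
              (by simp only [List.length_cons]; push_cast; linarith)
              (by simp only [List.length_cons]; omega)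
            exact this
        _ = _ := by rw [Finset.sum_const, Finset.card_range, nsmul_eq_mul]
    rw [show k + 5 - 2 - (k + 1 + 1) = 1 by omega, show k + 5 - 2 - (k + 1 + 1 + 1) = 0 by omega,
      show k + 5 - 2 - 0 = k + 3 by omega, show k + 5 - 2 - (0 + 1) = k + 2 by omega]
    rw [show k + 1 + 1 = k + 2 by omega, show k + 2 + 1 = k + 3 by omega, zero_add,
      hC.symm (List.Perm.swap 0 (k+3) r), hC.symm (List.Perm.swap 1 (k+2) r),
      hC.dilaton _ (by simp)]
    linarith
  have hJ := mul_le_mul_of_nonneg_left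
    (J5 r.length g (k+4) x (by linarith) hl (by omega) (by nlinarith)) (by linarith : 0 ≤ q)
  refine le_trans (hD.trans (add_le_add le_rfl (add_le_add
    (mul_le_mul_of_nonneg_left hsum hw) hS))) (le_trans (le_of_eq ?_) hJ)
  push_cast; ring
end

end

section
variable {C : List ℕ → ℚ}

theorem exists_min (l : List ℕ) (h : l ≠ []) : ∃ d ∈ l, ∀ i ∈ l, d ≤ i := by
  obtain ⟨d, hd, hm⟩ := Finset.exists_min_image l.toFinset id
    (by rwa [List.toFinset_nonempty_iff])
  exact ⟨d, by simpa using hd, fun i hi => hm i (by simpa using hi)⟩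

theorem Bnd_all (hC : IsNormalizedWitten C) {q : ℚ} (hq : 318/1000 ≤ q)
    (hq' : q ≤ 319/1000) (hone : ∀ n : ℕ, C [3*n+1] ≤ q * G1 (2*n+1)) (N : ℕ) : Bnd C q N := by
  induction N with
  | zero =>
    intro l g x hne h1 hg hx hN
    have := len_pos hne
    have := sum_ge 1 l h1
    omega
  | succ N hB =>
    intro l g x hne h1 hg hx hN
    rcases Nat.lt_or_ge (2 * g + l.length) (N + 2) with h | h
    · exact hB l g x hne h1 hg hx h
    have hN' : 2 * g + l.length = N + 2 := by omega
    have hs1 := sum_ge 1 l h1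
    have hg1 : 1 ≤ g := by have := len_pos hne; omega
    rcases Nat.eq_or_lt_of_le (len_pos hne) with hl | hl
    · obtain ⟨d, rfl⟩ := List.length_eq_one_iff.1 hl.symm
      simp only [List.length_singleton, List.sum_singleton] at *
      obtain ⟨n, rfl⟩ : ∃ n, g = n + 1 := ⟨g - 1, by omega⟩
      have hd : d = 3 * n + 1 := by omega
      subst hd
      rw [Gf_one, show x = 2 * n + 1 by push_cast at hx; linarith]
      exact hone n
    · obtain ⟨d, hd, hmin⟩ := exists_min l hne
      have hp := List.perm_cons_erase hd
      have hs : l.sum = d + (l.erase d).sum := by rw [hp.sum_eq]; simp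
      have hlen : l.length = (l.erase d).length + 1 := by rw [hp.length_eq]; simp
      have hne' : l.erase d ≠ [] := by
        intro h; rw [h] at hlen; simp at hlen; omega
      have hr : ∀ i ∈ l.erase d, d ≤ i := fun i hi => hmin i (List.mem_of_mem_erase hi)
      have hd1 := h1 d hd
      rw [hC.symm hp, hlen]
      generalize l.erase d = r at *
      rw [hs, hlen] at hg
      rw [hlen] at hx hN'
      push_cast at hx
      match d, hd1, hr, hg with
      | 1, _, hr, hg =>
        rw [hC.dilaton _ hne']
        refine (hB r g (x-1) hne' hr (by omega) (by linarith) (by omega)).trans ?_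
        apply mul_le_mul_of_nonneg_left _ (by linarith)
        exact Gf_F1 r.length g x (len_pos hne') hg1 (by linarith)
      | 2, _, hr, hg => exact step2 hC hq hq' hB r hne' hr g x hg hx hN'
      | 3, _, hr, hg => exact step3 hC hq hq' hB r hne' hr g x hg hx hN'
      | 4, _, hr, hg => exact step4 hC hq hq' hB r hne' hr g x hg hx hN'
      | k + 5, _, hr, hg => exact step5 hC hq hq' hB k r hne' hr g x hg hx hN'

theorem C_le_inv_pi (hC : IsNormalizedWitten C) (l : List ℕ) (hne : l ≠ [])
    (h1 : ∀ i ∈ l, 1 ≤ i) (hI : IG l) : (C l : ℝ) ≤ 1 / Real.pi := by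
  by_contra hcon
  push Not at hcon
  have hpi1 : 1 / Real.pi < (319/1000 : ℝ) := by
    rw [div_lt_iff₀ Real.pi_pos]
    have := Real.pi_gt_d4
    linarith
  have hpi2 : (318/1000 : ℝ) < 1 / Real.pi := by
    rw [lt_div_iff₀ Real.pi_pos]
    have := Real.pi_lt_d4
    linarith
  obtain ⟨q, hq1, hq2⟩ := exists_rat_btwn (lt_min hcon hpi1)
  have hqC : (q:ℝ) < C l := hq2.trans_le (min_le_left _ _)
  have hq319 : (q:ℝ) < 319/1000 := hq2.trans_le (min_le_right _ _)
  have hqC' : q < C l := by exact_mod_cast hqC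
  have hq' : q ≤ 319/1000 := by
    have : (q:ℝ) ≤ ((319/1000 : ℚ) : ℝ) := by push_cast; linarith
    exact_mod_cast this
  have hq : 318/1000 ≤ q := by
    have : ((318/1000 : ℚ) : ℝ) ≤ q := by push_cast; linarith
    exact_mod_cast this
  have hone : ∀ n : ℕ, C [3*n+1] ≤ q * G1 (2*n+1) := by
    intro n
    have h := C_one_bound hC n
    have hn : (0:ℝ) ≤ n := by positivity
    have : (C [3*n+1] : ℝ) ≤ ((q * G1 (2*n+1) : ℚ) : ℝ) := by
      refine h.trans ?_
      unfold G1
      push_cast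
      have e : (47/50 : ℝ) / (2 * n + 1 + 1) = (47/100)/((n:ℝ)+1) := by
        field_simp; ring
      rw [e]
      apply mul_le_mul_of_nonneg_right hq1.le
      have : (47/100)/((n:ℝ)+1) ≤ 1 := by
        rw [div_le_one (by linarith)]; linarith
      linarith
    exact_mod_cast this
  obtain ⟨g, hg⟩ := hI
  have := le_q hC hq (Bnd_all hC hq hq' hone (2 * g + l.length)) _ l g rfl hne h1 hg (by omega)
  linarith

theorem f_ge (X : ℕ) : ∀ n, 1 / Real.pi ≤ f X n := by
  induction X using Nat.strong_induction_on with
  | _ X ih =>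
    intro n
    rw [f]
    split_ifs with h
    · exact le_rfl
    · push Not at h
      have h1 := ih (X-1) (by omega) (n-1)
      have h2 := ih (X-1) (by omega) (n+1)
      have hX : (8:ℝ) ≤ X := by exact_mod_cast h.1
      have : 0 ≤ 4 / (((X : ℝ) - 1) * ((X : ℝ) - 2)) := by
        apply div_nonneg (by norm_num)
        apply mul_nonneg <;> linarith
      linarith
end

theorem theta_le_f (C : List ℕ → ℚ) (hC : IsNormalizedWitten C) :
    ∀ X n : ℕ, 1 ≤ X → 1 ≤ n →
      theta C X n ≤ f X n ∧
      ∀ e : List ℕ, e.length = n → (∀ i ∈ e, 1 ≤ i) → IntegralG e →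
        XQ e = (X : ℚ) → (C e : ℝ) ≤ f X n := by
  intro X n hX hn
  have key : ∀ e : List ℕ, e.length = n → (∀ i ∈ e, 1 ≤ i) → IntegralG e →
        XQ e = (X : ℚ) → (C e : ℝ) ≤ f X n := by
    intro e he h1 hI _
    have hne : e ≠ [] := by rintro rfl; simp at he; omega
    exact (C_le_inv_pi hC e hne h1 ((integralG_iff e).1 hI)).trans (f_ge X n)
  refine ⟨?_, key⟩
  unfold theta
  apply Real.sSup_le
  · rintro y ⟨e, he, h1, hI, hx, rfl⟩
    exact key e he h1 hI hx
  · have : 0 < 1 / Real.pi := by positivity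
    exact this.le.trans (f_ge X n)

end WittenAsym
end
end
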